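/- arXiv:2109.13583 — 2 statements merged into one kernel-verified Lean document; each statement's English description precedes it below -/
import Mathlib

section
/- On the hexagonal lattice: suppose the inverse temperature sequence β = β_L satisfies e^{β_L} ≪ L^{2/3}, and suppose two sequences g₁(L), g₂(L) satisfy 1 ≪ g₁(L) ≪ L² e^{−3β_L} ≪ g₂(L). Then μ_{β_L}(X_{[g₁(L), g₂(L)]}) = 1 − o_L(1) as L → ∞. -/
open scoped Classical BigOperators

namespace IsingHex

/-- Sites of the hexagonal lattice of side length `L` with periodic boundary conditions,
identified with the `2L²` triangular faces of the dual triangular lattice `Λ*`: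
`(p, false)` is the up-triangle and `(p, true)` the down-triangle in the rhombic cell `p`. -/
abbrev Site (L : ℕ) : Type := (ZMod L × ZMod L) × Bool

/-- Spin configurations `X = Ω^Λ` with spin set `Ω = Fin q`. -/
abbrev Conf (L q : ℕ) : Type := Site L → Fin q

/-- Adjacency of the hexagonal lattice: the up-triangle `(p, false)` is adjacent to the
down-triangles `(p, true)`, `(p - (1,0), true)` and `(p - (0,1), true)`. -/
def hexAdj {L : ℕ} (v w : Site L) : Prop :=
  (v.2 = false ∧ w.2 = true ∧
     (w.1 = v.1 ∨ w.1 = (v.1.1 - 1, v.1.2) ∨ w.1 = (v.1.1, v.1.2 - 1))) ∨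
  (v.2 = true ∧ w.2 = false ∧
     (v.1 = w.1 ∨ v.1 = (w.1.1 - 1, w.1.2) ∨ v.1 = (w.1.1, w.1.2 - 1)))

/-- The Hamiltonian `H(σ)`: the number of edges of `Λ` whose endpoints carry different
spins; each edge is counted exactly once through its unique up-triangle endpoint. -/
noncomputable def Ham (L q : ℕ) (σ : Conf L q) : ℕ :=
  Nat.card {e : Site L × Site L // e.1.2 = false ∧ hexAdj e.1 e.2 ∧ σ e.1 ≠ σ e.2}

/-- The monochromatic ground state `𝐚`. -/
def groundConf (L q : ℕ) (a : Fin q) : Conf L q := fun _ => a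

/-- The set `S = {𝟏, …, 𝐪}` of ground states. -/
def groundSet (L q : ℕ) : Set (Conf L q) := {σ | ∃ a : Fin q, σ = groundConf L q a}

/-- Partition function `Z_β`. -/
noncomputable def Zfun (L q : ℕ) (β : ℝ) : ℝ :=
  ∑' σ : Conf L q, Real.exp (-β * (Ham L q σ : ℝ))

/-- Gibbs measure of a set of configurations. -/
noncomputable def gibbsP (L q : ℕ) (β : ℝ) (A : Set (Conf L q)) : ℝ :=
  (∑' σ : Conf L q, A.indicator (fun ζ => Real.exp (-β * (Ham L q ζ : ℝ))) σ) / Zfun L q β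

/-- `σ ∼ ζ`: the two configurations differ at exactly one site. -/
def oneFlip {L q : ℕ} (σ ζ : Conf L q) : Prop :=
  ∃ x : Site L, σ x ≠ ζ x ∧ ∀ y : Site L, y ≠ x → σ y = ζ y

/-- Metropolis jump rates `c_β(σ, ζ)`. -/
noncomputable def rate (L q : ℕ) (β : ℝ) (σ ζ : Conf L q) : ℝ :=
  if oneFlip σ ζ then Real.exp (-β * max ((Ham L q ζ : ℝ) - (Ham L q σ : ℝ)) 0) else 0

/-- There is a `t`-path of single spin flips connecting `σ` and `ζ`. -/
def ConnBelow (L q : ℕ) (t : ℕ) (σ ζ : Conf L q) : Prop :=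
  ∃ (N : ℕ) (ω : ℕ → Conf L q), ω 0 = σ ∧ ω N = ζ ∧
    (∀ n < N, oneFlip (ω n) (ω (n + 1))) ∧ ∀ n ≤ N, Ham L q (ω n) ≤ t

/-- Communication height `Φ(σ, ζ)`. -/
noncomputable def commHeight (L q : ℕ) (σ ζ : Conf L q) : ℕ :=
  sInf {t : ℕ | ConnBelow L q t σ ζ}

/-- The strip of index `ℓ` in direction `d` (`0` = horizontal, `1` = vertical,
`2` = diagonal): `2L` consecutive triangles winding around the torus. -/
def stripSet (L : ℕ) (d : Fin 3) (ℓ : ZMod L) : Set (Site L) :=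
  if d = 0 then {v | v.1.2 = ℓ}
  else if d = 1 then {v | v.1.1 = ℓ}
  else {v | (v.2 = false ∧ v.1.1 + v.1.2 = ℓ) ∨ (v.2 = true ∧ v.1.1 + v.1.2 = ℓ - 1)}

/-- Strip energy `ΔH_s(σ)`: number of adjacent pairs inside the strip with different spins. -/
noncomputable def stripEnergy (L q : ℕ) (σ : Conf L q) (d : Fin 3) (ℓ : ZMod L) : ℕ :=
  Nat.card {e : Site L × Site L //
    e.1.2 = false ∧ e.1 ∈ stripSet L d ℓ ∧ e.2 ∈ stripSet L d ℓ ∧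
      hexAdj e.1 e.2 ∧ σ e.1 ≠ σ e.2}

/-- The strip `(d, ℓ)` is an `a`-bridge of `σ`. -/
def IsBridgeWith (L q : ℕ) (σ : Conf L q) (d : Fin 3) (ℓ : ZMod L) (a : Fin q) : Prop :=
  ∀ v ∈ stripSet L d ℓ, σ v = a

/-- The strip `(d, ℓ)` is a bridge of `σ`. -/
def IsBridge (L q : ℕ) (σ : Conf L q) (d : Fin 3) (ℓ : ZMod L) : Prop :=
  ∃ a : Fin q, IsBridgeWith L q σ d ℓ a

/-- Cyclic enumeration of the strip `(d, ℓ)` by `ZMod (2L)`, consecutive triangles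
being adjacent. -/
def stripCycle (L : ℕ) (d : Fin 3) (ℓ : ZMod L) (k : ZMod (2 * L)) : Site L :=
  let t : ZMod L := ((k.val / 2 : ℕ) : ZMod L)
  if d = 0 then ((t, ℓ), decide (k.val % 2 = 1))
  else if d = 1 then ((ℓ, t), decide (k.val % 2 = 1))
  else if k.val % 2 = 1 then ((t, ℓ - 1 - t), true) else ((t, ℓ - t), false)

/-- A set of triangles is an arc (a set of consecutive triangles) of the strip `(d, ℓ)`. -/
def IsArc (L : ℕ) (d : Fin 3) (ℓ : ZMod L) (S : Set (Site L)) : Prop :=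
  ∃ (s : ZMod (2 * L)) (m : ℕ),
    S = (fun k : ℕ => stripCycle L d ℓ (s + (k : ZMod (2 * L)))) '' Set.Iio m

/-- The strip `(d, ℓ)` is an `{a,b}`-semibridge of `σ`: it carries exactly the two
spins `a ≠ b`, and the sites carrying each spin are consecutive in the strip. -/
def IsSemibridgePair (L q : ℕ) (σ : Conf L q) (d : Fin 3) (ℓ : ZMod L) (a b : Fin q) : Prop :=
  a ≠ b ∧ (∀ v ∈ stripSet L d ℓ, σ v = a ∨ σ v = b) ∧
    (∃ v ∈ stripSet L d ℓ, σ v = a) ∧ (∃ v ∈ stripSet L d ℓ, σ v = b) ∧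
    IsArc L d ℓ {v ∈ stripSet L d ℓ | σ v = a} ∧ IsArc L d ℓ {v ∈ stripSet L d ℓ | σ v = b}

/-- The strip `(d, ℓ)` is a semibridge of `σ`. -/
def IsSemibridge (L q : ℕ) (σ : Conf L q) (d : Fin 3) (ℓ : ZMod L) : Prop :=
  ∃ a b : Fin q, IsSemibridgePair L q σ d ℓ a b

/-- `σ` has an `a`-cross: two `a`-bridges in different directions. -/
def HasCross (L q : ℕ) (σ : Conf L q) (a : Fin q) : Prop :=
  ∃ (d d' : Fin 3) (ℓ ℓ' : ZMod L),
    d ≠ d' ∧ IsBridgeWith L q σ d ℓ a ∧ IsBridgeWith L q σ d' ℓ' a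

/-- `σ` is cross-free. -/
def CrossFree (L q : ℕ) (σ : Conf L q) : Prop := ∀ a : Fin q, ¬ HasCross L q σ a

/-- Connected subsets of the torus `𝕋_L` of strip indices (the collection `𝔖_L`). -/
def CircConn (L : ℕ) (P : Set (ZMod L)) : Prop :=
  ∀ x ∈ P, ∀ y ∈ P, ∃ (N : ℕ) (γ : ℕ → ZMod L), γ 0 = x ∧ γ N = y ∧
    (∀ n ≤ N, γ n ∈ P) ∧ ∀ n < N, γ (n + 1) = γ n + 1 ∨ γ (n + 1) = γ n - 1

/-- Union of the strips with indices in `P`, in direction `d`. -/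
def stripUnion (L : ℕ) (d : Fin 3) (P : Set (ZMod L)) : Set (Site L) :=
  ⋃ ℓ ∈ P, stripSet L d ℓ

/-- The configuration `ξ^{a,b}_U`: spin `b` on `U` and spin `a` elsewhere. -/
noncomputable def xiConf (L q : ℕ) (a b : Fin q) (U : Set (Site L)) : Conf L q :=
  fun v => if v ∈ U then b else a

/-- `σ ∈ R_n^{a,b}`: a regular configuration between `𝐚` and `𝐛` built from `n` strips. -/
def IsRegular (L q : ℕ) (σ : Conf L q) (a b : Fin q) (n : ℕ) : Prop :=
  ∃ (d : Fin 3) (P : Set (ZMod L)), CircConn L P ∧ P.ncard = n ∧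
    σ = xiConf L q a b (stripUnion L d P)

/-- The vertices (in the triangular lattice) of the triangle `v`. -/
def triVerts (L : ℕ) (v : Site L) : Set (ZMod L × ZMod L) :=
  if v.2 = false then {v.1, (v.1.1 + 1, v.1.2), (v.1.1, v.1.2 + 1)}
  else {(v.1.1 + 1, v.1.2), (v.1.1, v.1.2 + 1), (v.1.1 + 1, v.1.2 + 1)}

/-- A connected set of triangles (connected through shared sides). -/
def ConnSet (L : ℕ) (U : Set (Site L)) : Prop :=
  ∀ x ∈ U, ∀ y ∈ U, ∃ (N : ℕ) (γ : ℕ → Site L), γ 0 = x ∧ γ N = y ∧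
    (∀ n ≤ N, γ n ∈ U) ∧ ∀ n < N, hexAdj (γ n) (γ (n + 1))

/-- A one-dimensional canonical set inside the strip `(d, ℓ)`. -/
def OneDimCanonical (L : ℕ) (d : Fin 3) (ℓ : ZMod L) (U : Set (Site L)) : Prop :=
  U ⊆ stripSet L d ℓ ∧ U.Nonempty ∧ U ≠ stripSet L d ℓ ∧
  (ConnSet L U ∨
    (Even U.ncard ∧ ∃ (U₁ : Set (Site L)) (y : Site L),
      U = U₁ ∪ {y} ∧ y ∉ U₁ ∧ U₁.Nonempty ∧ ConnSet L U₁ ∧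
      (∀ x ∈ U₁, ¬ hexAdj x y) ∧ ∃ x ∈ U₁, (triVerts L x ∩ triVerts L y).Nonempty))

/-- `P ≺ P'`: connected index sets with `P ⊆ P'` and `|P'| = |P| + 1`. -/
def StepPair (L : ℕ) (P P' : Set (ZMod L)) : Prop :=
  CircConn L P ∧ CircConn L P' ∧ P ⊆ P' ∧ P'.ncard = P.ncard + 1

/-- A protuberance attached to `s(P)` inside the strip `(d, ℓ)`: a one-dimensional
canonical set such that, when `1 ≤ |P| ≤ L-2`, at least half of its triangles share a
side with `s(P)`. -/
def IsProtuberance (L : ℕ) (d : Fin 3) (P : Set (ZMod L)) (ℓ : ZMod L)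
    (U : Set (Site L)) : Prop :=
  OneDimCanonical L d ℓ U ∧
    (1 ≤ P.ncard → P.ncard ≤ L - 2 →
      U.ncard ≤ 2 * {x ∈ U | ∃ y ∈ stripUnion L d P, hexAdj x y}.ncard)

/-- `‖σ‖_a`: the number of sites with spin `a`. -/
noncomputable def spinCount (L q : ℕ) (σ : Conf L q) (a : Fin q) : ℕ :=
  Nat.card {x : Site L // σ x = a}

/-- `N̂(S)`: configurations connected to a ground state by a `(2L+2)`-path. -/
def NHatGround (L q : ℕ) : Set (Conf L q) :=
  {ζ | ∃ a : Fin q, ConnBelow L q (2 * L + 2) (groundConf L q a) ζ}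

/-- A nice pair of configurations (relative to the partition class `A`). -/
def NicePair (L q : ℕ) (A : Finset (Fin q)) (σ ζ : Conf L q) : Prop :=
  σ ∉ NHatGround L q ∧ ζ ∉ NHatGround L q ∧ oneFlip σ ζ ∧
    (∑ a ∈ A, spinCount L q σ a) = L ^ 2 ∧ (∑ a ∈ A, spinCount L q ζ a) = L ^ 2 - 1

/-- `u` is the vector of mean hitting times `σ ↦ E_σ[τ_A]` of the Metropolis dynamics:
it vanishes on `A` and satisfies the first-step (harmonicity) equations off `A`. -/
def IsMeanHittingTime (L q : ℕ) (β : ℝ) (A : Set (Conf L q)) (u : Conf L q → ℝ) : Prop :=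
  (∀ σ ∈ A, u σ = 0) ∧
    ∀ σ ∉ A, (∑' ζ : Conf L q, rate L q β σ ζ) * u σ =
      1 + ∑' ζ : Conf L q, rate L q β σ ζ * u ζ

/-- Gibbs weight `μ_β(σ)`. -/
noncomputable def gibbsWeight (L q : ℕ) (β : ℝ) (σ : Conf L q) : ℝ :=
  Real.exp (-β * (Ham L q σ : ℝ)) / Zfun L q β

/-- The Dirichlet form `D_β(f)`. -/
noncomputable def dirichletForm (L q : ℕ) (β : ℝ) (f : Conf L q → ℝ) : ℝ :=
  (1 / 2) * ∑' p : Conf L q × Conf L q,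
    gibbsWeight L q β p.1 * rate L q β p.1 p.2 * (f p.2 - f p.1) ^ 2

/-- `h` is the equilibrium potential `h^β_{A,B}(σ) = P_σ[τ_A < τ_B]`: it equals `1` on
`A`, `0` on `B`, and is harmonic for the Metropolis dynamics off `A ∪ B`. -/
def IsEqPotential (L q : ℕ) (β : ℝ) (A B : Set (Conf L q)) (h : Conf L q → ℝ) : Prop :=
  (∀ σ ∈ A, h σ = 1) ∧ (∀ σ ∈ B, h σ = 0) ∧
    ∀ σ, σ ∉ A → σ ∉ B → (∑' ζ : Conf L q, rate L q β σ ζ * (h σ - h ζ)) = 0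



/-! ### Local geometry of the lattice -/

/-- The down-triangle neighbours of an up-triangle. -/
def dn {L : ℕ} (p : ZMod L × ZMod L) : Fin 3 → ZMod L × ZMod L :=
  ![p, (p.1 - 1, p.2), (p.1, p.2 - 1)]

/-- The disagreement indicator of the `k`-th edge at the up-triangle `p`. -/
noncomputable def dd {L q : ℕ} (σ : Conf L q) (p : ZMod L × ZMod L) (k : Fin 3) : ℕ :=
  if σ (p, false) = σ (dn p k, true) then 0 else 1

lemma one_ne {L : ℕ} (hL : 3 ≤ L) : (1 : ZMod L) ≠ 0 := by
  intro h
  have : ((1 : ℕ) : ZMod L) = 0 := by simpa using h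
  rw [ZMod.natCast_eq_zero_iff] at this
  have := Nat.le_of_dvd (by norm_num) this
  omega

lemma two_ne {L : ℕ} (hL : 3 ≤ L) : (2 : ZMod L) ≠ 0 := by
  intro h
  have : ((2 : ℕ) : ZMod L) = 0 := by simpa using h
  rw [ZMod.natCast_eq_zero_iff] at this
  have := Nat.le_of_dvd (by norm_num) this
  omega

lemma dn_inj {L : ℕ} (hL : 3 ≤ L) (p : ZMod L × ZMod L) : Function.Injective (dn p) := by
  have h1 := one_ne hL
  have h5 : ∀ a : ZMod L, a ≠ a - 1 := by
    intro a h
    apply h1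
    linear_combination h
  obtain ⟨a, b⟩ := p
  intro i j hij
  fin_cases i <;> fin_cases j <;> simp_all [dn, Prod.ext_iff]

lemma Ham_eq {L q : ℕ} [NeZero L] (hL : 3 ≤ L) (σ : Conf L q) :
    Ham L q σ = ∑ p : ZMod L × ZMod L, (dd σ p 0 + dd σ p 1 + dd σ p 2) := by
  have key : Ham L q σ = Nat.card {pk : (ZMod L × ZMod L) × Fin 3 //
      σ (pk.1, false) ≠ σ (dn pk.1 pk.2, true)} := by
    unfold Ham
    symm
    apply Nat.card_congr
    refine Equiv.ofBijective (fun pk => ⟨((pk.1.1, false), (dn pk.1.1 pk.1.2, true)), ?_⟩) ⟨?_, ?_⟩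
    · refine ⟨rfl, ?_, pk.2⟩
      left
      refine ⟨rfl, rfl, ?_⟩
      rcases pk with ⟨⟨p, k⟩, h⟩
      fin_cases k <;> simp [dn]
    · rintro ⟨⟨p, k⟩, h⟩ ⟨⟨p', k'⟩, h'⟩ he
      simp only [Subtype.mk.injEq, Prod.mk.injEq] at he
      obtain ⟨⟨rfl, -⟩, h2, -⟩ := he
      have := dn_inj hL p h2
      subst this
      rfl
    · rintro ⟨⟨⟨p, s⟩, ⟨r, t⟩⟩, hs, hadj, hne⟩
      simp only at hs
      subst hs
      rcases hadj with ⟨_, ht, hr⟩ | ⟨h, _⟩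
      · simp only at ht hr
        subst ht
        rcases hr with hr | hr | hr
        · refine ⟨⟨(p, 0), ?_⟩, ?_⟩ <;> simp [dn, hr]; simpa [hr] using hne
        · refine ⟨⟨(p, 1), ?_⟩, ?_⟩ <;> simp [dn, hr]; simpa [hr] using hne
        · refine ⟨⟨(p, 2), ?_⟩, ?_⟩ <;> simp [dn, hr]; simpa [hr] using hne
      · simp at h
  rw [key, Nat.card_eq_fintype_card, Fintype.card_subtype, Finset.card_filter,
    Fintype.sum_prod_type]
  refine Finset.sum_congr rfl fun p _ => ?_
  rw [Fin.sum_univ_three]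
  simp only [dd, ne_eq, ite_not]

/-- The six triangles around the dual vertex `v`, in cyclic order. -/
def tri {L : ℕ} (v : ZMod L × ZMod L) : Fin 6 → Site L :=
  ![((v.1, v.2), false), ((v.1 - 1, v.2), true), ((v.1 - 1, v.2), false),
    ((v.1 - 1, v.2 - 1), true), ((v.1, v.2 - 1), false), ((v.1, v.2 - 1), true)]

/-- The six dual neighbours of the dual vertex `v`. -/
def nb {L : ℕ} (v : ZMod L × ZMod L) : Fin 6 → ZMod L × ZMod L :=
  ![(v.1, v.2 + 1), (v.1 - 1, v.2 + 1), (v.1 - 1, v.2), (v.1, v.2 - 1),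
    (v.1 + 1, v.2 - 1), (v.1 + 1, v.2)]

/-- The `k`-th dual edge at `v` separates different spins. -/
def dis {L q : ℕ} (σ : Conf L q) (v : ZMod L × ZMod L) (k : Fin 6) : Prop :=
  σ (tri v k) ≠ σ (tri v (k + 1))

lemma nb_inj {L : ℕ} (hL : 3 ≤ L) (p : ZMod L × ZMod L) : Function.Injective (nb p) := by
  have h1 := one_ne hL
  have h2 := two_ne hL
  have h3 : ∀ a : ZMod L, a - 1 ≠ a + 1 := by
    intro a h
    apply h2
    linear_combination -h
  have h5 : ∀ a : ZMod L, a ≠ a - 1 := by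
    intro a h
    apply h1
    linear_combination h
  have h4 : ∀ a : ZMod L, a + 1 ≠ a - 1 := fun a => (h3 a).symm
  obtain ⟨a, b⟩ := p
  intro i j hij
  fin_cases i <;> fin_cases j <;> simp_all [nb, Prod.ext_iff]

lemma nb_ne {L : ℕ} (hL : 3 ≤ L) (p : ZMod L × ZMod L) (k : Fin 6) : nb p k ≠ p := by
  have h1 := one_ne hL
  obtain ⟨a, b⟩ := p
  fin_cases k <;> simp_all [nb, Prod.ext_iff]

lemma nb_back {L : ℕ} (v : ZMod L × ZMod L) (k : Fin 6) :
    nb (nb v k) (k + 3) = v ∧ tri (nb v k) (k + 3) = tri v (k + 1) ∧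
      tri (nb v k) (k + 3 + 1) = tri v k := by
  obtain ⟨a, b⟩ := v
  fin_cases k <;> simp [nb, tri]

lemma dis_back {L q : ℕ} (σ : Conf L q) (v : ZMod L × ZMod L) (k : Fin 6) (h : dis σ v k) :
    dis σ (nb v k) (k + 3) := by
  obtain ⟨_, h2, h3⟩ := nb_back v k
  unfold dis at *
  rw [h2, h3]
  exact h.symm

lemma dis_two {L q : ℕ} (σ : Conf L q) (v : ZMod L × ZMod L) (k : Fin 6) (h : dis σ v k) :
    ∃ j, j ≠ k ∧ dis σ v j := by
  by_contra hc
  push Not at hc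
  apply h
  have e := fun j hj => not_not.1 (hc j hj)
  have e0 := e 0
  have e1 := e 1
  have e2 := e 2
  have e3 := e 3
  have e4 := e 4
  have e5 := e 5
  clear e hc h
  generalize σ ∘ tri v = c at *
  fin_cases k <;> simp [tri] at * <;> grind

/-- Dual vertices whose surrounding hexagon is not monochromatic. -/
noncomputable def bad {L q : ℕ} [NeZero L] (σ : Conf L q) : Finset (ZMod L × ZMod L) :=
  Finset.univ.filter fun v => ∃ k, dis σ v k

lemma sum_dis {L q : ℕ} [NeZero L] (hL : 3 ≤ L) (σ : Conf L q) :
    ∑ v : ZMod L × ZMod L, ∑ k, (if dis σ v k then 1 else 0) = 2 * Ham L q σ := by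
  have s1 : ∀ f : ZMod L × ZMod L → ℕ, ∑ v : ZMod L × ZMod L, f (v.1 - 1, v.2) = ∑ v, f v := by
    intro f
    have := Equiv.sum_comp (Equiv.subRight ((1, 0) : ZMod L × ZMod L)) f
    rw [← this]
    refine Finset.sum_congr rfl fun v _ => ?_
    simp [Prod.sub_def]
  have s2 : ∀ f : ZMod L × ZMod L → ℕ, ∑ v : ZMod L × ZMod L, f (v.1, v.2 - 1) = ∑ v, f v := by
    intro f
    have := Equiv.sum_comp (Equiv.subRight ((0, 1) : ZMod L × ZMod L)) f
    rw [← this]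
    refine Finset.sum_congr rfl fun v _ => ?_
    simp [Prod.sub_def]
  have e : ∀ v : ZMod L × ZMod L, ∑ k, (if dis σ v k then 1 else 0)
      = dd σ v 1 + dd σ (v.1 - 1, v.2) 0 + dd σ (v.1 - 1, v.2) 2 + dd σ (v.1, v.2 - 1) 1
        + dd σ (v.1, v.2 - 1) 0 + dd σ v 2 := by
    intro v
    rw [Fin.sum_univ_six]
    have c : ∀ a b : Site L, (if σ a = σ b then (0 : ℕ) else 1) = if σ b = σ a then 0 else 1 := by
      intro a b
      simp [eq_comm]
    simp [dis, dd, tri, dn]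
    rw [c ((v.1 - 1, v.2), true), c ((v.1 - 1, v.2 - 1), true), c ((v.1, v.2 - 1), true) (v, false)]
    rfl
  simp only [e, Finset.sum_add_distrib]
  rw [s1 (fun v => dd σ v 0), s1 (fun v => dd σ v 2), s2 (fun v => dd σ v 0),
    s2 (fun v => dd σ v 1), Ham_eq hL]
  simp only [Finset.sum_add_distrib]
  ring

lemma bad_le {L q : ℕ} [NeZero L] (hL : 3 ≤ L) (σ : Conf L q) : (bad σ).card ≤ Ham L q σ := by
  have h := sum_dis hL σ
  have h2 : ∑ v ∈ bad σ, 2 ≤ ∑ v : ZMod L × ZMod L, ∑ k, (if dis σ v k then 1 else 0) := by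
    refine le_trans (Finset.sum_le_sum fun v hv => ?_)
      (Finset.sum_le_sum_of_subset (Finset.subset_univ (bad σ)))
    simp only [bad, Finset.mem_filter, Finset.mem_univ, true_and] at hv
    obtain ⟨k, hk⟩ := hv
    obtain ⟨j, hjk, hj⟩ := dis_two σ v k hk
    rw [← Finset.card_filter]
    calc 2 = ({j, k} : Finset (Fin 6)).card := (Finset.card_pair hjk).symm
      _ ≤ _ := Finset.card_le_card (by
        intro i hi
        simp only [Finset.mem_insert, Finset.mem_singleton] at hi
        rcases hi with rfl | rfl <;> simp [hj, hk])
  rw [h, Finset.sum_const, smul_eq_mul] at h2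
  omega

/-! ### Components of the disagreement set and seeds -/

/-- Two dual vertices are joined by a dual edge separating different spins. -/
def RR {L q : ℕ} (σ : Conf L q) (v w : ZMod L × ZMod L) : Prop := ∃ k, dis σ v k ∧ nb v k = w

lemma RR_symm {L q : ℕ} (σ : Conf L q) {v w : ZMod L × ZMod L} (h : RR σ v w) : RR σ w v := by
  obtain ⟨k, hk, rfl⟩ := h
  exact ⟨k + 3, dis_back σ v k hk, (nb_back v k).1⟩

lemma comp_symm {L q : ℕ} (σ : Conf L q) {v w : ZMod L × ZMod L}
    (h : Relation.ReflTransGen (RR σ) v w) : Relation.ReflTransGen (RR σ) w v := by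
  induction h with
  | refl => exact Relation.ReflTransGen.refl
  | tail _ h ih => exact Relation.ReflTransGen.head (RR_symm σ h) ih

/-- Components of the dual disagreement graph. -/
def comp {L q : ℕ} (σ : Conf L q) : Setoid (ZMod L × ZMod L) where
  r := Relation.ReflTransGen (RR σ)
  iseqv := ⟨fun _ => Relation.ReflTransGen.refl,
    fun h => comp_symm σ h,
    fun hab hbc => hab.trans hbc⟩

/-- Representative of the component of `v`. -/
noncomputable def rep {L q : ℕ} (σ : Conf L q) (v : ZMod L × ZMod L) : ZMod L × ZMod L :=
  (Quotient.mk (comp σ) v).out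

lemma rep_rel {L q : ℕ} (σ : Conf L q) (v : ZMod L × ZMod L) :
    Relation.ReflTransGen (RR σ) (rep σ v) v :=
  Quotient.exact (s := comp σ) (Quotient.out_eq _)

lemma rep_eq {L q : ℕ} (σ : Conf L q) {v w : ZMod L × ZMod L}
    (h : Relation.ReflTransGen (RR σ) v w) : rep σ v = rep σ w := by
  unfold rep
  rw [Quotient.sound (s := comp σ) h]

lemma RR_bad {L q : ℕ} [NeZero L] (σ : Conf L q) {v w : ZMod L × ZMod L} (h : RR σ v w) :
    v ∈ bad σ ∧ w ∈ bad σ := by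
  obtain ⟨j, hj, _⟩ := RR_symm σ h
  obtain ⟨k, hk, _⟩ := h
  simp only [bad, Finset.mem_filter, Finset.mem_univ, true_and]
  exact ⟨⟨k, hk⟩, ⟨j, hj⟩⟩

lemma reach_bad {L q : ℕ} [NeZero L] (σ : Conf L q) {v w : ZMod L × ZMod L}
    (h : Relation.ReflTransGen (RR σ) v w) (hw : w ∈ bad σ) : v ∈ bad σ := by
  rcases Relation.ReflTransGen.cases_head h with rfl | ⟨u, hu, _⟩
  · exact hw
  · exact (RR_bad σ hu).1

/-- One seed for each component. -/
noncomputable def seed {L q : ℕ} [NeZero L] (σ : Conf L q) : Finset (ZMod L × ZMod L) :=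
  (bad σ).image (rep σ)

lemma seed_sub {L q : ℕ} [NeZero L] (σ : Conf L q) : seed σ ⊆ bad σ := by
  intro s hs
  simp only [seed, Finset.mem_image] at hs
  obtain ⟨v, hv, rfl⟩ := hs
  exact reach_bad σ (rep_rel σ v) hv

lemma seed_card {L q : ℕ} [NeZero L] (hL : 3 ≤ L) (σ : Conf L q) :
    3 * (seed σ).card ≤ (bad σ).card := by
  refine Finset.mul_card_image_le_card _ _ fun s hs => ?_
  simp only [Finset.mem_image] at hs
  obtain ⟨v, hv, rfl⟩ := hs
  have hv' := hv
  simp only [bad, Finset.mem_filter, Finset.mem_univ, true_and] at hv'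
  obtain ⟨k, hk⟩ := hv'
  obtain ⟨j, hjk, hj⟩ := dis_two σ v k hk
  have rk : RR σ v (nb v k) := ⟨k, hk, rfl⟩
  have rj : RR σ v (nb v j) := ⟨j, hj, rfl⟩
  have hcard : ({v, nb v k, nb v j} : Finset (ZMod L × ZMod L)).card = 3 :=
    Finset.card_eq_three.2 ⟨v, nb v k, nb v j, (nb_ne hL v k).symm, (nb_ne hL v j).symm,
      fun h => hjk (nb_inj hL v h).symm, rfl⟩
  rw [← hcard]
  refine Finset.card_le_card fun w hw => ?_
  simp only [Finset.mem_insert, Finset.mem_singleton] at hw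
  rw [Finset.mem_filter]
  rcases hw with rfl | rfl | rfl
  · exact ⟨hv, rfl⟩
  · exact ⟨(RR_bad σ rk).2, (rep_eq σ (Relation.ReflTransGen.single rk)).symm⟩
  · exact ⟨(RR_bad σ rj).2, (rep_eq σ (Relation.ReflTransGen.single rj)).symm⟩

lemma seed_determines {L q : ℕ} [NeZero L] (σ τ ω : Conf L q) (hS : seed σ = seed τ)
    (h1 : ∀ v ∈ bad σ, ∀ k, ω (tri v k) = σ (tri v k))
    (h2 : ∀ v ∈ bad τ, ∀ k, ω (tri v k) = τ (tri v k)) : bad σ ⊆ bad τ := by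
  intro v hv
  have hs : rep σ v ∈ bad τ := by
    apply seed_sub
    rw [← hS]
    exact Finset.mem_image_of_mem _ hv
  have key : ∀ w, Relation.ReflTransGen (RR σ) (rep σ v) w → w ∈ bad τ := by
    intro w hw
    induction hw with
    | refl => exact hs
    | tail _ hstep ih =>
      have hb := (RR_bad σ hstep).1
      obtain ⟨k, hk, hkw⟩ := hstep
      have : RR τ _ _ := ⟨k, (by
        unfold dis at *
        rw [← h2 _ ih, ← h2 _ ih, h1 _ hb, h1 _ hb]
        exact hk), hkw⟩
      exact (RR_bad τ this).2
  exact key v (rep_rel σ v)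

lemma lattice_conn {L : ℕ} [NeZero L] (P : Site L → Prop) (h0 : P ((0, 0), false))
    (hstep : ∀ (v : ZMod L × ZMod L) (k : Fin 6), P (tri v k) ↔ P (tri v (k + 1))) :
    ∀ x, P x := by
  have hall : ∀ v k, P (tri v k) ↔ P (tri v 0) := by
    intro v k
    have a0 := hstep v 0
    have a1 := hstep v 1
    have a2 := hstep v 2
    have a3 := hstep v 3
    have a4 := hstep v 4
    have a5 := hstep v 5
    fin_cases k <;> simp at * <;> tauto
  have r1 : ∀ a b : ZMod L, P ((a, b), false) ↔ P ((a - 1, b), false) := by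
    intro a b
    have := hall (a, b) 2
    simpa [tri, iff_comm] using this
  have r2 : ∀ a b : ZMod L, P ((a, b), false) ↔ P ((a, b - 1), false) := by
    intro a b
    have := hall (a, b) 4
    simpa [tri, iff_comm] using this
  have n1 : ∀ n : ℕ, P (((n : ZMod L), 0), false) := by
    intro n
    induction n with
    | zero => simpa using h0
    | succ n ih =>
      rw [r1]
      simpa using ih
  have n2 : ∀ n m : ℕ, P (((n : ZMod L), (m : ZMod L)), false) := by
    intro n m
    induction m with
    | zero => simpa using n1 n
    | succ m ih =>
      rw [r2]
      simpa using ih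
  have up : ∀ a b : ZMod L, P ((a, b), false) := by
    intro a b
    have := n2 a.val b.val
    simpa using this
  rintro ⟨⟨a, b⟩, s⟩
  cases s
  · exact up a b
  · have h := (hall (a + 1, b) 1).2 (by simpa [tri] using up (a + 1) b)
    simpa [tri] using h

/-- The triangles touching the disagreement set. -/
noncomputable def touch {L q : ℕ} [NeZero L] (σ : Conf L q) : Finset (Site L) :=
  (bad σ).biUnion fun v => Finset.univ.image (tri v)

lemma touch_card {L q : ℕ} [NeZero L] (σ : Conf L q) : (touch σ).card ≤ 6 * (bad σ).card := by
  unfold touch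
  rw [mul_comm]
  refine Finset.card_biUnion_le_card_mul _ _ _ fun v _ => ?_
  exact le_trans Finset.card_image_le (by simp)

lemma conf_determined {L q : ℕ} [NeZero L] (σ τ ω : Conf L q) (hS : seed σ = seed τ)
    (h0 : σ ((0, 0), false) = τ ((0, 0), false))
    (h1 : ∀ x ∈ touch σ, ω x = σ x) (h2 : ∀ x ∈ touch τ, ω x = τ x) : σ = τ := by
  have h1' : ∀ v ∈ bad σ, ∀ k, ω (tri v k) = σ (tri v k) := by
    intro v hv k
    exact h1 _ (Finset.mem_biUnion.2 ⟨v, hv, Finset.mem_image_of_mem _ (Finset.mem_univ k)⟩)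
  have h2' : ∀ v ∈ bad τ, ∀ k, ω (tri v k) = τ (tri v k) := by
    intro v hv k
    exact h2 _ (Finset.mem_biUnion.2 ⟨v, hv, Finset.mem_image_of_mem _ (Finset.mem_univ k)⟩)
  have hb : bad σ = bad τ := Finset.Subset.antisymm (seed_determines σ τ ω hS h1' h2')
    (seed_determines τ σ ω hS.symm h2' h1')
  funext x
  revert x
  refine lattice_conn (fun x => σ x = τ x) h0 fun v k => ?_
  by_cases hv : v ∈ bad σ
  · have hv' := hb ▸ hv
    simp only [← h1' v hv, ← h2' v hv']
  · have hv' : v ∉ bad τ := by rwa [← hb]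
    have e1 : σ (tri v k) = σ (tri v (k + 1)) := by
      by_contra hne
      exact hv (Finset.mem_filter.2 ⟨Finset.mem_univ _, k, hne⟩)
    have e2 : τ (tri v k) = τ (tri v (k + 1)) := by
      by_contra hne
      exact hv' (Finset.mem_filter.2 ⟨Finset.mem_univ _, k, hne⟩)
    rw [e1, e2]

lemma cyl_card {L q : ℕ} [NeZero L] (σ : Conf L q) (T : Finset (Site L)) :
    (Finset.univ.filter fun ω : Conf L q => ∀ x ∈ T, ω x = σ x).card * q ^ T.card
      = Fintype.card (Conf L q) := by
  have e : (Finset.univ.filter fun ω : Conf L q => ∀ x ∈ T, ω x = σ x)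
      = Fintype.piFinset fun x => if x ∈ T then {σ x} else Finset.univ := by
    ext ω
    simp only [Finset.mem_filter, Finset.mem_univ, true_and, Fintype.mem_piFinset]
    refine forall_congr' fun x => ?_
    by_cases hx : x ∈ T <;> simp [hx]
  rw [e, Fintype.card_piFinset]
  have : q ^ T.card = ∏ x : Site L, if x ∈ T then q else 1 := by
    simp
  rw [this, ← Finset.prod_mul_distrib, Fintype.card_fun, Fintype.card_fin]
  rw [← Finset.card_univ, ← Finset.prod_const]
  refine Finset.prod_congr rfl fun x _ => ?_
  by_cases hx : x ∈ T <;> simp [hx]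

lemma class_sum {L q : ℕ} [NeZero L] (hq : 1 ≤ q) (S : Finset (ZMod L × ZMod L)) (a : Fin q) :
    ∑ σ ∈ Finset.univ.filter (fun σ : Conf L q => seed σ = S ∧ σ ((0, 0), false) = a),
      ((q : ℝ) ^ (6 * (bad σ).card))⁻¹ ≤ 1 := by
  set C := Finset.univ.filter (fun σ : Conf L q => seed σ = S ∧ σ ((0, 0), false) = a) with hC
  let cyl : Conf L q → Finset (Conf L q) := fun σ =>
    Finset.univ.filter fun ω : Conf L q => ∀ x ∈ touch σ, ω x = σ x
  have hdisj : (C : Set (Conf L q)).PairwiseDisjoint cyl := by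
    intro σ hσ τ hτ hne
    refine Finset.disjoint_left.2 fun ω h1 h2 => hne ?_
    simp only [hC, Finset.coe_filter, Set.mem_ofPred_eq, Finset.mem_univ, true_and] at hσ hτ
    simp only [cyl, Finset.mem_filter, Finset.mem_univ, true_and] at h1 h2
    exact conf_determined σ τ ω (hσ.1.trans hτ.1.symm) (hσ.2.trans hτ.2.symm) h1 h2
  have hsum : ∑ σ ∈ C, (cyl σ).card ≤ Fintype.card (Conf L q) := by
    rw [← Finset.card_biUnion hdisj]
    exact Finset.card_le_univ _
  have hqp : (0 : ℝ) < q := by exact_mod_cast hq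
  have hq1 : (1 : ℝ) ≤ q := by exact_mod_cast hq
  have hM : (0 : ℝ) < Fintype.card (Conf L q) := by
    have : 0 < Fintype.card (Conf L q) := by
      rw [Fintype.card_fun, Fintype.card_fin]
      positivity
    exact_mod_cast this
  have hle : ∀ σ, ((q : ℝ) ^ (6 * (bad σ).card))⁻¹ ≤ (cyl σ).card / Fintype.card (Conf L q) := by
    intro σ
    have h := cyl_card σ (touch σ)
    have h' : ((cyl σ).card : ℝ) * (q : ℝ) ^ (touch σ).card = Fintype.card (Conf L q) := by
      exact_mod_cast h
    rw [le_div_iff₀ hM, ← h', inv_mul_le_iff₀ (by positivity), mul_comm]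
    gcongr
    exact touch_card σ
  calc _ ≤ ∑ σ ∈ C, ((cyl σ).card : ℝ) / Fintype.card (Conf L q) :=
        Finset.sum_le_sum fun σ _ => hle σ
    _ = (∑ σ ∈ C, (cyl σ).card : ℕ) / Fintype.card (Conf L q) := by
        rw [← Finset.sum_div]
        push_cast
        rfl
    _ ≤ 1 := by
        rw [div_le_one hM]
        exact_mod_cast hsum

/-- The upper bound on the partition function. -/
lemma Z_upper {L q : ℕ} [NeZero L] (hL : 3 ≤ L) (hq : 1 ≤ q) (z : ℝ) (hz : 0 ≤ z)
    (hz1 : (q : ℝ) ^ 6 * z ≤ 1) :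
    ∑ σ : Conf L q, z ^ Ham L q σ ≤ q * Real.exp ((L : ℝ) ^ 2 * ((q : ℝ) ^ 6 * z) ^ 3) := by
  have hqp : (0 : ℝ) < q := by exact_mod_cast hq
  set y := (q : ℝ) ^ 6 * z with hy
  have hy0 : 0 ≤ y := by positivity
  have hpt : ∀ σ : Conf L q, z ^ Ham L q σ
      ≤ ((q : ℝ) ^ (6 * (bad σ).card))⁻¹ * (y ^ 3) ^ (seed σ).card := by
    intro σ
    have hb := bad_le hL σ
    have hs := seed_card hL σ
    have hq1 : (1 : ℝ) ≤ q := by exact_mod_cast hq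
    have hzy : z = ((q : ℝ) ^ 6)⁻¹ * y := by
      rw [hy]
      field_simp
    rw [hzy, mul_pow, pow_mul, ← pow_mul y, inv_pow]
    gcongr ?_ * ?_
    · rw [inv_le_inv₀ (by positivity) (by positivity)]
      exact pow_le_pow_right₀ (one_le_pow₀ hq1) hb
    · exact pow_le_pow_of_le_one hy0 hz1 (hs.trans hb)
  have hfib : ∑ σ : Conf L q, ((q : ℝ) ^ (6 * (bad σ).card))⁻¹ * (y ^ 3) ^ (seed σ).card
      = ∑ Sa : Finset (ZMod L × ZMod L) × Fin q,
        ∑ σ ∈ Finset.univ.filter (fun σ : Conf L q => (seed σ, σ ((0, 0), false)) = Sa),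
          ((q : ℝ) ^ (6 * (bad σ).card))⁻¹ * (y ^ 3) ^ (seed σ).card :=
    (Finset.sum_fiberwise _ _ _).symm
  calc _ ≤ ∑ σ : Conf L q, ((q : ℝ) ^ (6 * (bad σ).card))⁻¹ * (y ^ 3) ^ (seed σ).card :=
        Finset.sum_le_sum fun σ _ => hpt σ
    _ ≤ ∑ Sa : Finset (ZMod L × ZMod L) × Fin q, (y ^ 3) ^ Sa.1.card := by
        rw [hfib]
        refine Finset.sum_le_sum fun Sa _ => ?_
        obtain ⟨S, a⟩ := Sa
        simp only [Prod.mk.injEq]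
        calc _ = ∑ σ ∈ Finset.univ.filter
              (fun σ : Conf L q => seed σ = S ∧ σ ((0, 0), false) = a),
              ((q : ℝ) ^ (6 * (bad σ).card))⁻¹ * (y ^ 3) ^ S.card := by
              refine Finset.sum_congr rfl fun σ hσ => ?_
              simp only [Finset.mem_filter] at hσ
              rw [hσ.2.1]
          _ ≤ 1 * (y ^ 3) ^ S.card := by
              rw [← Finset.sum_mul]
              gcongr
              exact class_sum hq S a
          _ = _ := one_mul _
    _ = q * (1 + y ^ 3) ^ (L ^ 2) := by
        rw [Fintype.sum_prod_type_right]
        simp only [Finset.sum_const, Finset.card_univ, Fintype.card_fin, nsmul_eq_mul]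
        congr 1
        have := Fintype.sum_pow_mul_eq_add_pow (ZMod L × ZMod L) (y ^ 3) (1 : ℝ)
        simp only [one_pow, mul_one, Fintype.card_prod, ZMod.card] at this
        rw [this, add_comm, sq]
    _ ≤ _ := by
        gcongr
        have := Real.add_one_le_exp (y ^ 3)
        calc (1 + y ^ 3) ^ (L ^ 2) ≤ (Real.exp (y ^ 3)) ^ (L ^ 2) := by
              gcongr
              linarith
          _ = _ := by
              rw [← Real.exp_nat_mul]
              push_cast
              rfl

/-! ### The lower tail -/

/-- Apply the spin permutation `π` at the up-triangle `p`. -/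
noncomputable def flipAt {L q : ℕ} (π : Equiv.Perm (Fin q)) (p : ZMod L × ZMod L) :
    Conf L q ≃ Conf L q :=
  Equiv.piCongrRight fun y => if y = (p, false) then π else Equiv.refl _

lemma flipAt_self {L q : ℕ} (π : Equiv.Perm (Fin q)) (p : ZMod L × ZMod L) (σ : Conf L q) :
    flipAt π p σ (p, false) = π (σ (p, false)) := by
  simp [flipAt]

lemma flipAt_other {L q : ℕ} (π : Equiv.Perm (Fin q)) (p : ZMod L × ZMod L) (σ : Conf L q)
    (y : Site L) (hy : y ≠ (p, false)) : flipAt π p σ y = σ y := by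
  simp [flipAt, hy]

lemma flip_iso {L q : ℕ} (π : Equiv.Perm (Fin q)) (hπ : ∀ a, π a ≠ a) (p : ZMod L × ZMod L)
    (σ : Conf L q) (hg : ∀ k, dd σ p k = 0) (k : Fin 3) : dd (flipAt π p σ) p k = 1 := by
  have h := hg k
  unfold dd at *
  rw [flipAt_self, flipAt_other _ _ _ _ (by simp)]
  have e : σ (p, false) = σ (dn p k, true) := by
    by_contra hne
    simp [hne] at h
  rw [← e]
  simp [hπ]

lemma flip_Ham {L q : ℕ} [NeZero L] (hL : 3 ≤ L) (π : Equiv.Perm (Fin q)) (hπ : ∀ a, π a ≠ a)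
    (p : ZMod L × ZMod L) (σ : Conf L q) (hg : ∀ k, dd σ p k = 0) :
    Ham L q (flipAt π p σ) = Ham L q σ + 3 := by
  rw [Ham_eq hL, Ham_eq hL, ← Finset.add_sum_erase _ _ (Finset.mem_univ p),
    ← Finset.add_sum_erase (a := p) (f := fun p => dd σ p 0 + dd σ p 1 + dd σ p 2) _
      (Finset.mem_univ p)]
  have h : ∀ r ∈ Finset.univ.erase p, ∀ k, dd (flipAt π p σ) r k = dd σ r k := by
    intro r hr k
    have hr' : r ≠ p := Finset.ne_of_mem_erase hr
    unfold dd
    rw [flipAt_other _ _ _ (r, false) (by simpa using hr'), flipAt_other _ _ _ _ (by simp)]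
  rw [Finset.sum_congr rfl fun r hr => by rw [h r hr, h r hr, h r hr]]
  simp only [flip_iso π hπ p σ hg, hg]
  ring

lemma good_card {L q : ℕ} [NeZero L] (hL : 3 ≤ L) (σ : Conf L q) :
    L ^ 2 ≤ (Finset.univ.filter fun p : ZMod L × ZMod L => ∀ k, dd σ p k = 0).card
      + Ham L q σ := by
  have h1 : (Finset.univ : Finset (ZMod L × ZMod L)).card = L ^ 2 := by
    simp [Finset.card_univ, ZMod.card, sq]
  have h2 := Finset.card_filter_add_card_filter_not (s := (Finset.univ : Finset (ZMod L × ZMod L)))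
    (fun p => ∀ k, dd σ p k = 0)
  have h3 : (Finset.univ.filter fun p : ZMod L × ZMod L => ¬ ∀ k, dd σ p k = 0).card
      ≤ Ham L q σ := by
    rw [Ham_eq hL, Finset.card_filter]
    refine Finset.sum_le_sum fun p _ => ?_
    split_ifs with h
    · exact Nat.zero_le _
    · by_contra hc
      apply h
      intro k
      fin_cases k <;> simp <;> omega
  omega

lemma iso_card {L q : ℕ} [NeZero L] (hL : 3 ≤ L) (σ : Conf L q) :
    (Finset.univ.filter fun p : ZMod L × ZMod L => ∀ k, dd σ p k = 1).card ≤ Ham L q σ := by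
  rw [Ham_eq hL, Finset.card_filter]
  refine Finset.sum_le_sum fun p _ => ?_
  split_ifs with h
  · rw [h 0]
    omega
  · exact Nat.zero_le _

lemma lower_tail {L q : ℕ} [NeZero L] (hL : 3 ≤ L) (hq : 2 ≤ q) (z g : ℝ) (hz : 0 < z)
    (hg : 0 ≤ g) :
    (∑ σ : Conf L q, if (Ham L q σ : ℝ) < g then z ^ Ham L q σ else 0)
      * (z ^ 3 * ((L : ℝ) ^ 2 - g)) ≤ (g + 3) * ∑ σ : Conf L q, z ^ Ham L q σ := by
  obtain ⟨π, hπ⟩ : ∃ π : Equiv.Perm (Fin q), ∀ a, π a ≠ a := by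
    obtain ⟨n, rfl⟩ := Nat.exists_eq_add_of_le' hq
    exact ⟨Equiv.addRight 1, fun a => by simp⟩
  let F : (ZMod L × ZMod L) → Conf L q → ℝ := fun p ζ =>
    if (Ham L q ζ : ℝ) < g + 3 ∧ ∀ k, dd ζ p k = 1 then z ^ Ham L q ζ else 0
  calc _ ≤ ∑ σ : Conf L q, ∑ p : ZMod L × ZMod L,
        (if (Ham L q σ : ℝ) < g ∧ ∀ k, dd σ p k = 0 then z ^ (Ham L q σ + 3) else 0) := by
        rw [Finset.sum_mul]
        refine Finset.sum_le_sum fun σ _ => ?_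
        by_cases h : (Ham L q σ : ℝ) < g
        · simp only [h, if_true, true_and]
          rw [← Finset.sum_filter, Finset.sum_const, nsmul_eq_mul, pow_add]
          have hgc : ((L ^ 2 : ℕ) : ℝ) ≤ _ := Nat.cast_le.2 (good_card hL σ)
          push_cast at hgc
          have hp : 0 < z ^ Ham L q σ * z ^ 3 := by positivity
          rw [← mul_assoc, mul_comm]
          exact mul_le_mul_of_nonneg_right (by linarith) hp.le
        · simp [h]
    _ = ∑ p : ZMod L × ZMod L, ∑ σ : Conf L q,
        (if (Ham L q σ : ℝ) < g ∧ ∀ k, dd σ p k = 0 then z ^ (Ham L q σ + 3) else 0) :=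
        Finset.sum_comm
    _ ≤ ∑ p : ZMod L × ZMod L, ∑ σ : Conf L q, F p (flipAt π p σ) := by
        refine Finset.sum_le_sum fun p _ => Finset.sum_le_sum fun σ _ => ?_
        split_ifs with h
        · have hH := flip_Ham hL π hπ p σ h.2
          have : (Ham L q (flipAt π p σ) : ℝ) < g + 3 := by
            rw [hH]
            push_cast
            linarith [h.1]
          simp only [F]
          rw [if_pos ⟨this, flip_iso π hπ p σ h.2⟩, hH]
        · simp only [F]
          split_ifs <;> positivity
    _ = ∑ p : ZMod L × ZMod L, ∑ σ : Conf L q, F p σ := by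
        refine Finset.sum_congr rfl fun p _ => ?_
        exact Equiv.sum_comp (flipAt π p) (F p)
    _ = ∑ σ : Conf L q, ∑ p : ZMod L × ZMod L, F p σ := Finset.sum_comm
    _ ≤ _ := by
        rw [Finset.mul_sum]
        refine Finset.sum_le_sum fun σ _ => ?_
        by_cases h : (Ham L q σ : ℝ) < g + 3
        · simp only [F, h, true_and]
          rw [← Finset.sum_filter, Finset.sum_const, nsmul_eq_mul]
          have hgc : _ ≤ (Ham L q σ : ℝ) := Nat.cast_le.2 (iso_card hL σ)
          exact mul_le_mul_of_nonneg_right (by linarith) (by positivity)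
        · simp only [F, h, false_and, if_false, Finset.sum_const_zero]
          positivity

/-! ### The estimate at fixed side length -/

lemma window_bound {L q : ℕ} [NeZero L] (hL : 3 ≤ L) (hq : 2 ≤ q) (β g₁ g₂ : ℝ)
    (hg₁ : 0 ≤ g₁) (hg : g₁ < (L : ℝ) ^ 2) (hβ : (q : ℝ) ^ 6 * (2 * Real.exp (-β)) ≤ 1) :
    1 - (g₁ + 3) / (Real.exp (-β) ^ 3 * ((L : ℝ) ^ 2 - g₁))
      - q * Real.exp ((L : ℝ) ^ 2 * ((q : ℝ) ^ 6 * (2 * Real.exp (-β))) ^ 3 - Real.log 2 * g₂)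
      ≤ gibbsP L q β {σ : Conf L q | g₁ ≤ (Ham L q σ : ℝ) ∧ (Ham L q σ : ℝ) ≤ g₂}
    ∧ gibbsP L q β {σ : Conf L q | g₁ ≤ (Ham L q σ : ℝ) ∧ (Ham L q σ : ℝ) ≤ g₂} ≤ 1 := by
  set z := Real.exp (-β) with hz
  have hz0 : 0 < z := Real.exp_pos _
  have hw : ∀ σ : Conf L q, Real.exp (-β * (Ham L q σ : ℝ)) = z ^ Ham L q σ := by
    intro σ
    rw [hz, ← Real.exp_nat_mul, mul_comm]
  set A := {σ : Conf L q | g₁ ≤ (Ham L q σ : ℝ) ∧ (Ham L q σ : ℝ) ≤ g₂} with hA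
  unfold gibbsP Zfun
  rw [tsum_fintype, tsum_fintype]
  simp only [Set.indicator_apply, hw]
  set Z := ∑ σ : Conf L q, z ^ Ham L q σ with hZ
  have hZ1 : 1 ≤ Z := by
    have h0 : Ham L q (groundConf L q ⟨0, by omega⟩) = 0 := by
      rw [Ham_eq hL]
      simp [dd, groundConf]
    calc (1 : ℝ) = z ^ Ham L q (groundConf L q ⟨0, by omega⟩) := by rw [h0, pow_zero]
      _ ≤ Z := Finset.single_le_sum (f := fun σ : Conf L q => z ^ Ham L q σ)
          (fun σ _ => by positivity) (Finset.mem_univ _)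
  have hZ0 : 0 < Z := by linarith
  have hlow := lower_tail (q := q) hL hq z g₁ hz0 hg₁
  have hup := Z_upper hL (by omega : 1 ≤ q) (2 * z) (by positivity) hβ
  rw [← hZ] at hlow
  set Lo := ∑ σ : Conf L q, (if (Ham L q σ : ℝ) < g₁ then z ^ Ham L q σ else 0) with hLo
  set Up := ∑ σ : Conf L q, (if g₂ < (Ham L q σ : ℝ) then z ^ Ham L q σ else 0) with hUp
  have hsplit : Z ≤ (∑ σ : Conf L q, if σ ∈ A then z ^ Ham L q σ else 0) + Lo + Up := by
    rw [hZ, hLo, hUp, ← Finset.sum_add_distrib, ← Finset.sum_add_distrib]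
    refine Finset.sum_le_sum fun σ _ => ?_
    have hp : 0 < z ^ Ham L q σ := by positivity
    by_cases h1 : (Ham L q σ : ℝ) < g₁
    · simp only [h1, if_true]
      split_ifs <;> linarith
    · by_cases h2 : g₂ < (Ham L q σ : ℝ)
      · simp only [h2, if_true]
        split_ifs <;> linarith
      · have : σ ∈ A := ⟨not_lt.1 h1, not_lt.1 h2⟩
        simp [this, h1, h2]
  have hLo' : Lo / Z ≤ (g₁ + 3) / (z ^ 3 * ((L : ℝ) ^ 2 - g₁)) := by
    have : 0 < z ^ 3 * ((L : ℝ) ^ 2 - g₁) := mul_pos (by positivity) (by linarith)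
    rw [div_le_div_iff₀ hZ0 this]
    exact hlow
  have hUp0 : 0 ≤ Up := Finset.sum_nonneg fun σ _ => by split_ifs <;> positivity
  have hUp' : Up / Z ≤ q * Real.exp ((L : ℝ) ^ 2 * ((q : ℝ) ^ 6 * (2 * z)) ^ 3
      - Real.log 2 * g₂) := by
    refine (div_le_self hUp0 hZ1).trans ?_
    rw [sub_eq_add_neg, Real.exp_add, ← mul_assoc]
    refine le_trans ?_ (mul_le_mul_of_nonneg_right hup (Real.exp_pos _).le)
    rw [Finset.sum_mul]
    refine Finset.sum_le_sum fun σ _ => ?_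
    split_ifs with h
    · rw [mul_pow]
      have h2 : (2 : ℝ) ^ Ham L q σ = Real.exp (Real.log 2 * Ham L q σ) := by
        rw [mul_comm, Real.exp_nat_mul, Real.exp_log (by norm_num)]
      have h3 : 1 ≤ (2 : ℝ) ^ Ham L q σ * Real.exp (-(Real.log 2 * g₂)) := by
        rw [h2, ← Real.exp_add]
        apply Real.one_le_exp
        have := Real.log_pos (by norm_num : (1 : ℝ) < 2)
        nlinarith
      have hp : 0 < z ^ Ham L q σ := by positivity
      nlinarith
    · positivity
  constructor
  · have : 1 ≤ ((∑ σ : Conf L q, if σ ∈ A then z ^ Ham L q σ else 0) + Lo + Up) / Z := by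
      rwa [le_div_iff₀ hZ0, one_mul]
    rw [add_div, add_div] at this
    linarith
  · rw [div_le_one hZ0]
    refine Finset.sum_le_sum fun σ _ => ?_
    split_ifs
    · exact le_rfl
    · positivity

/-- Lemma 4.3 (hexagonal lattice): if `e^{β_L} ≪ L^{2/3}` and positive sequences satisfy
`1 ≪ g₁(L) ≪ L² e^{-3β_L} ≪ g₂(L)`, then `μ_β(X_{[g₁(L), g₂(L)]}) = 1 - o_L(1)`. -/
theorem gibbs_concentration_window (q : ℕ) (hq : 2 ≤ q) (β : ℕ → ℝ)
    (hβ : Filter.Tendsto β Filter.atTop Filter.atTop)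
    (hcond : Filter.Tendsto (fun L : ℕ => Real.exp (β L) / (L : ℝ) ^ ((2 : ℝ) / 3))
      Filter.atTop (nhds 0))
    (g₁ g₂ : ℕ → ℝ) (hg₁pos : ∀ L, 0 < g₁ L) (hg₂pos : ∀ L, 0 < g₂ L)
    (h1 : Filter.Tendsto (fun L : ℕ => 1 / g₁ L) Filter.atTop (nhds 0))
    (h2 : Filter.Tendsto
      (fun L : ℕ => g₁ L / ((L : ℝ) ^ 2 * Real.exp (-3 * β L)))
      Filter.atTop (nhds 0))
    (h3 : Filter.Tendsto
      (fun L : ℕ => ((L : ℝ) ^ 2 * Real.exp (-3 * β L)) / g₂ L)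
      Filter.atTop (nhds 0)) :
    Filter.Tendsto (fun L : ℕ => gibbsP L q (β L)
        {σ : Conf L q | g₁ L ≤ (Ham L q σ : ℝ) ∧ (Ham L q σ : ℝ) ≤ g₂ L})
      Filter.atTop (nhds 1) := by
  set ℓ : ℕ → ℝ := fun L : ℕ => (L : ℝ) ^ 2 * Real.exp (-3 * β L) with hℓ
  have hg1inf : Filter.Tendsto g₁ Filter.atTop Filter.atTop := by
    have : Filter.Tendsto (fun L => 1 / g₁ L) Filter.atTop (nhdsWithin 0 (Set.Ioi 0)) :=
      tendsto_nhdsWithin_iff.2 ⟨h1, Filter.Eventually.of_forall fun L => by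
        have := hg₁pos L
        simp only [Set.mem_Ioi]
        positivity⟩
    have h := this.inv_tendsto_nhdsGT_zero
    refine h.congr fun L => ?_
    simp
  have hℓpos : ∀ᶠ L in Filter.atTop, 0 < ℓ L := by
    filter_upwards [Filter.eventually_ge_atTop 1] with L hL
    have : (0 : ℝ) < L := by exact_mod_cast hL
    simp only [hℓ]
    positivity
  have hε : Filter.Tendsto (fun L => Real.exp (-β L)) Filter.atTop (nhds 0) :=
    Real.tendsto_exp_neg_atTop_nhds_zero.comp hβ
  have hℓg1 : ∀ᶠ L in Filter.atTop, g₁ L ≤ (1 / 2) * ℓ L := by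
    filter_upwards [hℓpos, h2.eventually (gt_mem_nhds (by norm_num : (0 : ℝ) < 1 / 2))]
      with L hp h
    exact ((div_lt_iff₀ hp).1 h).le
  have hℓle : ∀ᶠ L in Filter.atTop, ℓ L ≤ (L : ℝ) ^ 2 := by
    filter_upwards [hβ.eventually_ge_atTop 0] with L hL
    have : Real.exp (-3 * β L) ≤ 1 := Real.exp_le_one_iff.2 (by linarith)
    simp only [hℓ]
    nlinarith [sq_nonneg (L : ℝ)]
  have hg2inf : Filter.Tendsto g₂ Filter.atTop Filter.atTop := by
    refine Filter.tendsto_atTop_mono' _ ?_ hg1inf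
    filter_upwards [hℓpos, hℓg1, h3.eventually (gt_mem_nhds (by norm_num : (0 : ℝ) < 1))]
      with L hp ha hb
    have := (div_lt_iff₀ (hg₂pos L)).1 hb
    linarith
  have hlog : 0 < Real.log 2 := Real.log_pos (by norm_num)
  have hqpos : (0 : ℝ) < q := by
    have : 0 < q := by omega
    exact_mod_cast this
  -- the two error terms
  have hlow : Filter.Tendsto (fun L => 8 * (g₁ L / ℓ L)) Filter.atTop (nhds 0) := by
    have := h2.const_mul 8
    rwa [mul_zero] at this
  have hupp : Filter.Tendsto (fun L => (q : ℝ) * Real.exp (-(Real.log 2 / 2 * g₂ L)))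
      Filter.atTop (nhds 0) := by
    have : Filter.Tendsto (fun L => Real.log 2 / 2 * g₂ L) Filter.atTop Filter.atTop :=
      hg2inf.const_mul_atTop (by positivity)
    simpa using (Real.tendsto_exp_neg_atTop_nhds_zero.comp this).const_mul (q : ℝ)
  have hcst : (0 : ℝ) < Real.log 2 / 2 / (8 * (q : ℝ) ^ 18) := by positivity
  have hmain : ∀ᶠ L : ℕ in Filter.atTop,
      1 - 8 * (g₁ L / ℓ L) - (q : ℝ) * Real.exp (-(Real.log 2 / 2 * g₂ L))
        ≤ gibbsP L q (β L)
          {σ : Conf L q | g₁ L ≤ (Ham L q σ : ℝ) ∧ (Ham L q σ : ℝ) ≤ g₂ L}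
      ∧ gibbsP L q (β L)
          {σ : Conf L q | g₁ L ≤ (Ham L q σ : ℝ) ∧ (Ham L q σ : ℝ) ≤ g₂ L} ≤ 1 := by
    have hεs : ∀ᶠ L in Filter.atTop, Real.exp (-β L) < 1 / (2 * (q : ℝ) ^ 6) :=
      hε.eventually (gt_mem_nhds (by positivity))
    filter_upwards [Filter.eventually_ge_atTop 3, hℓpos, hℓg1, hℓle, hεs,
      hg1inf.eventually_ge_atTop 1, h3.eventually (gt_mem_nhds hcst)]
      with L hL hp hg1 hle hes hg1' hg2
    have : NeZero L := ⟨by omega⟩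
    have hεp := Real.exp_pos (-β L)
    have hcube : Real.exp (-β L) ^ 3 = Real.exp (-3 * β L) := by
      rw [← Real.exp_nat_mul]
      congr 1
      push_cast
      ring
    have hL2 : (0 : ℝ) < (L : ℝ) ^ 2 := lt_of_lt_of_le hp hle
    have hb := window_bound (L := L) hL hq (β L) (g₁ L) (g₂ L) (hg₁pos L).le (by linarith) (by
      rw [lt_div_iff₀ (by positivity)] at hes
      linarith)
    refine ⟨le_trans ?_ hb.1, hb.2⟩
    have e1 : (g₁ L + 3) / (Real.exp (-β L) ^ 3 * ((L : ℝ) ^ 2 - g₁ L)) ≤ 8 * (g₁ L / ℓ L) := by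
      have hden : ℓ L / 2 ≤ Real.exp (-β L) ^ 3 * ((L : ℝ) ^ 2 - g₁ L) := by
        rw [hcube]
        have : (L : ℝ) ^ 2 / 2 ≤ (L : ℝ) ^ 2 - g₁ L := by linarith
        have := mul_le_mul_of_nonneg_left this (Real.exp_pos (-3 * β L)).le
        simp only [hℓ]
        linarith
      calc _ ≤ (4 * g₁ L) / (ℓ L / 2) := by
            apply div_le_div₀ <;> linarith
        _ = _ := by
            field_simp
            norm_num
    have e2 : (L : ℝ) ^ 2 * ((q : ℝ) ^ 6 * (2 * Real.exp (-β L))) ^ 3 - Real.log 2 * g₂ L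
        ≤ -(Real.log 2 / 2 * g₂ L) := by
      have hx : (L : ℝ) ^ 2 * ((q : ℝ) ^ 6 * (2 * Real.exp (-β L))) ^ 3
          = (8 * (q : ℝ) ^ 18) * ℓ L := by
        simp only [hℓ]
        rw [← hcube]
        ring
      rw [hx]
      have h := (div_lt_iff₀ (hg₂pos L)).1 hg2
      have h' : (8 * (q : ℝ) ^ 18) * ℓ L
          ≤ (8 * (q : ℝ) ^ 18) * (Real.log 2 / 2 / (8 * (q : ℝ) ^ 18) * g₂ L) :=
        mul_le_mul_of_nonneg_left h.le (by positivity)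
      have h'' : (8 * (q : ℝ) ^ 18) * (Real.log 2 / 2 / (8 * (q : ℝ) ^ 18) * g₂ L)
          = Real.log 2 / 2 * g₂ L := by
        field_simp
      linarith
    have e3 := mul_le_mul_of_nonneg_left (Real.exp_le_exp.2 e2) hqpos.le
    linarith
  have hlim : Filter.Tendsto (fun L => 1 - 8 * (g₁ L / ℓ L)
      - (q : ℝ) * Real.exp (-(Real.log 2 / 2 * g₂ L))) Filter.atTop (nhds 1) := by
    simpa using (tendsto_const_nhds.sub hlow).sub hupp
  exact tendsto_of_tendsto_of_tendsto_of_le_of_le' hlim tendsto_const_nhds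
    (hmain.mono fun L h => h.1) (hmain.mono fun L h => h.2)

end IsingHex
end

section
/- On the hexagonal lattice with L ≥ 8: suppose a cross-free configuration σ ∈ X satisfies H(σ) ≤ 2L+2, has exactly k ∈ {L−2, L−1} horizontal bridges, and has at least one vertical or diagonal semibridge. Then: (1) there exist two spins a, b ∈ Ω such that every horizontal bridge of σ is either an a-bridge or a b-bridge; (2) defining P_c = {ℓ ∈ T_L : the ℓ-th horizontal strip is a c-bridge} for c ∈ {a,b}, if P_a and P_b are both nonempty then P_a and P_b are connected subsets of the torus T_L, and moreover: (a) if k = L−2 then all non-bridge strips of σ are {a,b}-semibridges and H(σ) = 2L+2; (b) if k = L−1 and H(σ) ≤ 2L+1 then all non-bridge strips of σ are {a,b}-semibridges. -/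
open scoped Classical BigOperators

namespace IsingHex

/-- natural-number version of `stripCycle` -/
def cyc (L : ℕ) (d : Fin 3) (ℓ : ZMod L) (k : ℕ) : Site L :=
  if d = 0 then ((((k / 2 : ℕ) : ZMod L), ℓ), decide (k % 2 = 1))
  else if d = 1 then ((ℓ, ((k / 2 : ℕ) : ZMod L)), decide (k % 2 = 1))
  else if k % 2 = 1 then ((((k / 2 : ℕ) : ZMod L), ℓ - 1 - ((k / 2 : ℕ) : ZMod L)), true)
  else ((((k / 2 : ℕ) : ZMod L), ℓ - ((k / 2 : ℕ) : ZMod L)), false)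

lemma half_cast (L k : ℕ) : (((k % (2 * L)) / 2 : ℕ) : ZMod L) = ((k / 2 : ℕ) : ZMod L) := by
  have : k % (2 * L) / 2 = (k / 2) % L := by
    rw [Nat.mod_mul_right_div_self]
  rw [this, ZMod.natCast_mod]

lemma stripCycle_cast (L : ℕ) (d : Fin 3) (ℓ : ZMod L) (k : ℕ) :
    stripCycle L d ℓ (k : ZMod (2 * L)) = cyc L d ℓ k := by
  have h2 : k % (2 * L) % 2 = k % 2 := Nat.mod_mul_right_mod k 2 L
  unfold stripCycle cyc
  simp only [ZMod.val_natCast, half_cast, h2]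

lemma cyc_periodic (L : ℕ) (d : Fin 3) (ℓ : ZMod L) (k : ℕ) :
    cyc L d ℓ (k + 2 * L) = cyc L d ℓ k := by
  rw [← stripCycle_cast, ← stripCycle_cast, Nat.cast_add, ZMod.natCast_self, add_zero]

lemma cyc_mem (L : ℕ) (d : Fin 3) (ℓ : ZMod L) (k : ℕ) : cyc L d ℓ k ∈ stripSet L d ℓ := by
  unfold cyc stripSet
  split_ifs <;> simp

lemma exists_cyc (L : ℕ) [NeZero L] (d : Fin 3) (ℓ : ZMod L) (v : Site L)
    (hv : v ∈ stripSet L d ℓ) : ∃ k < 2 * L, cyc L d ℓ k = v := by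
  obtain ⟨⟨x, y⟩, p⟩ := v
  unfold stripSet at hv
  unfold cyc
  have hx := ZMod.val_lt x
  have hy := ZMod.val_lt y
  have e0 : ∀ n : ℕ, 2 * n / 2 = n := fun n => by omega
  have e1 : ∀ n : ℕ, (2 * n + 1) / 2 = n := fun n => by omega
  have e2 : ∀ n : ℕ, 2 * n % 2 = 0 := fun n => by omega
  have e3 : ∀ n : ℕ, (2 * n + 1) % 2 = 1 := fun n => by omega
  split_ifs at hv ⊢ with h0 h1
  · cases p
    · exact ⟨2 * x.val, by omega, by simp_all⟩
    · exact ⟨2 * x.val + 1, by omega, by simp_all⟩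
  · cases p
    · exact ⟨2 * y.val, by omega, by simp_all⟩
    · exact ⟨2 * y.val + 1, by omega, by simp_all⟩
  · cases p
    · refine ⟨2 * x.val, by omega, ?_⟩
      simp at hv
      simp [e0, ← hv]
    · refine ⟨2 * x.val + 1, by omega, ?_⟩
      simp at hv
      simp [e1, e3, ← hv]

/-- spin sequence along a strip -/
def sq {L q : ℕ} (σ : Conf L q) (d : Fin 3) (ℓ : ZMod L) (k : ℕ) : Fin q := σ (cyc L d ℓ k)

/-- number of changes -/
noncomputable def chg {q : ℕ} (N : ℕ) (f : ℕ → Fin q) : ℕ :=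
  N.count (fun k => f k ≠ f (k + 1))

lemma chg_window {q : ℕ} (N : ℕ) (f : ℕ → Fin q) (hf : ∀ k, f (k + N) = f k) (s : ℕ) :
    ((Finset.Ico s (s + N)).filter (fun k => f k ≠ f (k + 1))).card = chg N f := by
  unfold chg
  apply Nat.filter_Ico_card_eq_of_periodic
  intro k
  have := hf (k + 1)
  simp only [hf k, show k + N + 1 = k + 1 + N by ring, this]

lemma exists_chg {q : ℕ} (f : ℕ → Fin q) (i j : ℕ) (hij : i ≤ j) (h : f i ≠ f j) :
    ∃ p, i ≤ p ∧ p < j ∧ f p ≠ f (p + 1) := by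
  by_contra! hc
  apply h
  induction j, hij using Nat.le_induction with
  | base => rfl
  | succ j hj ih =>
    by_cases hh : f i = f j
    · rw [hh]; exact hc j hj (by omega)
    · exact absurd (ih hh (fun p h1 h2 => hc p h1 (by omega))) hh

lemma two_le_chg {q : ℕ} (N : ℕ) (f : ℕ → Fin q) (hf : ∀ k, f (k + N) = f k) (i j : ℕ)
    (h1 : i ≤ j) (h2 : j ≤ i + N) (h : f i ≠ f j) : 2 ≤ chg N f := by
  obtain ⟨p, hp1, hp2, hp3⟩ := exists_chg f i j h1 h
  obtain ⟨r, hr1, hr2, hr3⟩ := exists_chg f j (i + N) h2 (by rw [hf]; exact h.symm)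
  rw [← chg_window N f hf i]
  have : ({p, r} : Finset ℕ).card = 2 := Finset.card_pair (by omega)
  rw [← this]
  apply Finset.card_le_card
  intro t ht
  simp only [Finset.mem_insert, Finset.mem_singleton] at ht
  simp only [Finset.mem_filter, Finset.mem_Ico]
  rcases ht with rfl | rfl
  · exact ⟨by omega, hp3⟩
  · exact ⟨by omega, hr3⟩

lemma four_le_chg {q : ℕ} (N : ℕ) (f : ℕ → Fin q) (hf : ∀ k, f (k + N) = f k) (z i v j : ℕ)
    (h1 : z ≤ i) (h2 : i ≤ v) (h3 : v ≤ j) (h4 : j ≤ z + N)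
    (hzi : f z ≠ f i) (hiv : f i ≠ f v) (hvj : f v ≠ f j) (hjz : f j ≠ f z) : 4 ≤ chg N f := by
  obtain ⟨p, hp1, hp2, hp3⟩ := exists_chg f z i h1 hzi
  obtain ⟨r, hr1, hr2, hr3⟩ := exists_chg f i v h2 hiv
  obtain ⟨s, hs1, hs2, hs3⟩ := exists_chg f v j h3 hvj
  obtain ⟨t, ht1, ht2, ht3⟩ := exists_chg f j (z + N) h4 (by rw [hf]; exact hjz)
  rw [← chg_window N f hf z]
  have : ({p, r, s, t} : Finset ℕ).card = 4 := by
    rw [Finset.card_insert_of_notMem, Finset.card_insert_of_notMem, Finset.card_pair] <;>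
      simp <;> omega
  rw [← this]
  apply Finset.card_le_card
  intro u hu
  simp only [Finset.mem_insert, Finset.mem_singleton] at hu
  simp only [Finset.mem_filter, Finset.mem_Ico]
  rcases hu with rfl | rfl | rfl | rfl
  · exact ⟨by omega, hp3⟩
  · exact ⟨by omega, hr3⟩
  · exact ⟨by omega, hs3⟩
  · exact ⟨by omega, ht3⟩

/-- exactly two changes: two arcs -/
lemma arcs_of_chg {q : ℕ} (N : ℕ) (f : ℕ → Fin q) (hf : ∀ k, f (k + N) = f k) (i j : ℕ)
    (h1 : i ≤ j) (h2 : j ≤ i + N) (h : f i ≠ f j) (hc : chg N f ≤ 2) :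
    ∃ p r, p < r ∧ r < p + N ∧ (∀ k, p < k → k ≤ r → f k = f j) ∧
      (∀ k, r < k → k ≤ p + N → f k = f i) := by
  obtain ⟨p, hp1, hp2, hp3⟩ := exists_chg f i j h1 h
  obtain ⟨r, hr1, hr2, hr3⟩ := exists_chg f j (i + N) h2 (by rw [hf]; exact h.symm)
  have key : ∀ t, i ≤ t → t < i + N → f t ≠ f (t + 1) → t = p ∨ t = r := by
    intro t t1 t2 t3
    by_contra! hh
    rw [← chg_window N f hf i] at hc
    have : ({p, r, t} : Finset ℕ).card = 3 := by
      rw [Finset.card_insert_of_notMem, Finset.card_pair] <;> simp <;> omega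
    have h3 : ({p, r, t} : Finset ℕ).card ≤
        ((Finset.Ico i (i + N)).filter (fun k => f k ≠ f (k + 1))).card := by
      apply Finset.card_le_card
      intro u hu
      simp only [Finset.mem_insert, Finset.mem_singleton] at hu
      simp only [Finset.mem_filter, Finset.mem_Ico]
      rcases hu with rfl | rfl | rfl
      · exact ⟨by omega, hp3⟩
      · exact ⟨by omega, hr3⟩
      · exact ⟨by omega, t3⟩
    omega
  have e : ∀ s t, i ≤ s → s ≤ t → t ≤ i + N → (∀ u, s ≤ u → u < t → u ≠ p ∧ u ≠ r) →
      f s = f t := by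
    intro s t hs hst ht hu
    by_contra hne
    obtain ⟨u, u1, u2, u3⟩ := exists_chg f s t hst hne
    have := hu u u1 u2
    have := key u (by omega) (by omega) u3
    omega
  refine ⟨p, r, by omega, by omega, ?_, ?_⟩
  · intro k k1 k2
    rcases le_total k j with hk | hk
    · exact e k j (by omega) hk (by omega) (by intros; omega)
    · exact (e j k (by omega) hk (by omega) (by intros; omega)).symm
  · intro k k1 k2
    rcases le_total k (i + N) with hk | hk
    · rw [← hf i]
      exact e k (i + N) (by omega) hk (by omega) (by intros; omega)
    · obtain ⟨m, rfl⟩ : ∃ m, k = m + N := ⟨k - N, by omega⟩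
      rw [hf m]
      exact (e i m (by omega) (by omega) (by omega) (by intros; omega)).symm

lemma sq_periodic {L q : ℕ} (σ : Conf L q) (d : Fin 3) (ℓ : ZMod L) (k : ℕ) :
    sq σ d ℓ (k + 2 * L) = sq σ d ℓ k := by
  unfold sq; rw [cyc_periodic]

lemma two_le_of_ne {L q : ℕ} [NeZero L] (σ : Conf L q) (d : Fin 3) (ℓ : ZMod L)
    (v w : Site L) (hv : v ∈ stripSet L d ℓ) (hw : w ∈ stripSet L d ℓ) (h : σ v ≠ σ w) :
    2 ≤ chg (2 * L) (sq σ d ℓ) := by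
  obtain ⟨i, hi, rfl⟩ := exists_cyc L d ℓ v hv
  obtain ⟨j, hj, rfl⟩ := exists_cyc L d ℓ w hw
  rcases le_total i j with hij | hij
  · exact two_le_chg _ _ (sq_periodic σ d ℓ) i j hij (by omega) h
  · exact two_le_chg _ _ (sq_periodic σ d ℓ) j i hij (by omega) h.symm

lemma two_le_of_not_bridge {L q : ℕ} [NeZero L] (σ : Conf L q) (d : Fin 3) (ℓ : ZMod L)
    (h : ¬ IsBridge L q σ d ℓ) : 2 ≤ chg (2 * L) (sq σ d ℓ) := by
  by_contra hc
  apply h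
  refine ⟨σ (cyc L d ℓ 0), fun v hv => ?_⟩
  by_contra hne
  exact hc (two_le_of_ne σ d ℓ v _ hv (cyc_mem L d ℓ 0) hne)

lemma isArc_of {L q : ℕ} [NeZero L] (σ : Conf L q) (d : Fin 3) (ℓ : ZMod L) (a b : Fin q)
    (hab : a ≠ b) (p r : ℕ) (hpr : p < r) (hr : r < p + 2 * L)
    (h1 : ∀ k, p < k → k ≤ r → sq σ d ℓ k = a)
    (h2 : ∀ k, r < k → k ≤ p + 2 * L → sq σ d ℓ k = b) :
    IsArc L d ℓ {v ∈ stripSet L d ℓ | σ v = a} := by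
  refine ⟨((p + 1 : ℕ) : ZMod (2 * L)), r - p, ?_⟩
  ext v
  simp only [← Nat.cast_add, stripCycle_cast, Set.mem_image, Set.mem_Iio, Set.mem_ofPred_eq]
  constructor
  · rintro ⟨hv, hva⟩
    obtain ⟨k, hk, rfl⟩ := exists_cyc L d ℓ v hv
    -- move k into the window (p, p+2L]
    obtain ⟨kk, hk1, hk2, hk3⟩ : ∃ kk, p < kk ∧ kk ≤ p + 2 * L ∧ cyc L d ℓ kk = cyc L d ℓ k := by
      refine ⟨p + 1 + (k + 2 * L * (p + 1) - (p + 1)) % (2 * L), by omega, ?_, ?_⟩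
      · have := Nat.mod_lt (k + 2 * L * (p + 1) - (p + 1)) (show 0 < 2 * L by omega)
        omega
      · rw [← stripCycle_cast, ← stripCycle_cast]
        congr 1
        have hle : p + 1 ≤ k + 2 * L * (p + 1) := by nlinarith
        rw [Nat.cast_add, ZMod.natCast_mod, ← Nat.cast_add, Nat.add_sub_cancel' hle, Nat.cast_add,
          Nat.cast_mul (2 * L), ZMod.natCast_self]
        simp
    have hkr : kk ≤ r := by
      by_contra hc
      have := h2 kk (by omega) hk2
      unfold sq at this
      rw [hk3] at this
      exact hab (hva.symm.trans this)
    refine ⟨kk - (p + 1), by omega, ?_⟩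
    rw [← hk3]; congr 1; omega
  · rintro ⟨k, hk, rfl⟩
    exact ⟨cyc_mem _ _ _ _, h1 _ (by omega) (by omega)⟩

lemma semibridge_of {L q : ℕ} [NeZero L] (σ : Conf L q) (d : Fin 3) (ℓ : ZMod L) (a b : Fin q)
    (hab : a ≠ b) (v w : Site L) (hv : v ∈ stripSet L d ℓ) (hw : w ∈ stripSet L d ℓ)
    (hva : σ v = a) (hwb : σ w = b) (hc : chg (2 * L) (sq σ d ℓ) ≤ 2) :
    IsSemibridgePair L q σ d ℓ a b := by
  have main : ∃ p r, p < r ∧ r < p + 2 * L ∧ (∀ k, p < k → k ≤ r → sq σ d ℓ k = b) ∧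
      (∀ k, r < k → k ≤ p + 2 * L → sq σ d ℓ k = a) := by
    obtain ⟨i, hi, rfl⟩ := exists_cyc L d ℓ v hv
    obtain ⟨j, hj, rfl⟩ := exists_cyc L d ℓ w hw
    have key := arcs_of_chg (2 * L) (sq σ d ℓ) (sq_periodic σ d ℓ)
    have hia : sq σ d ℓ i = a := hva
    have hjb : sq σ d ℓ j = b := hwb
    rcases le_total i j with hij | hij
    · have := key i j hij (by omega) (by rw [hia, hjb]; exact hab) hc
      rwa [hia, hjb] at this
    · have := key i (j + 2 * L) (by omega) (by omega)
        (by rw [sq_periodic, hia, hjb]; exact hab) hc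
      rwa [sq_periodic, hia, hjb] at this
  obtain ⟨p, r, hpr, hr, h1, h2⟩ := main
  have hB := isArc_of σ d ℓ b a hab.symm p r hpr hr h1 h2
  have hA := isArc_of σ d ℓ a b hab r (p + 2 * L) hr (by omega) h2 (by
    intro k k1 k2
    obtain ⟨m, rfl⟩ : ∃ m, k = m + 2 * L := ⟨k - 2 * L, by omega⟩
    rw [sq_periodic]; exact h1 m (by omega) (by omega))
  refine ⟨hab, ?_, ⟨v, hv, hva⟩, ⟨w, hw, hwb⟩, hA, hB⟩
  intro u hu
  obtain ⟨s, m, hs⟩ := hA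
  by_contra! hne
  -- locate u
  obtain ⟨k, hk, rfl⟩ := exists_cyc L d ℓ u hu
  obtain ⟨c, hc1⟩ : ∃ c : ℕ, c = (k + 2 * L * (p + 1) - (p + 1)) % (2 * L) := ⟨_, rfl⟩
  have hlt := Nat.mod_lt (k + 2 * L * (p + 1) - (p + 1)) (show 0 < 2 * L by omega)
  have hce : cyc L d ℓ (p + 1 + c) = cyc L d ℓ k := by
    rw [← stripCycle_cast, ← stripCycle_cast]
    congr 1
    have hle : p + 1 ≤ k + 2 * L * (p + 1) := by nlinarith
    rw [hc1, Nat.cast_add, ZMod.natCast_mod, ← Nat.cast_add, Nat.add_sub_cancel' hle, Nat.cast_add,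
      Nat.cast_mul (2 * L), ZMod.natCast_self]
    simp
  rw [← hce] at hne
  rcases le_or_gt (p + 1 + c) r with h | h
  · exact hne.2 (h1 _ (by omega) h)
  · exact hne.1 (h2 _ h (by omega))

lemma sum_range_zmod (L : ℕ) [NeZero L] (g : ZMod L → ℕ) :
    ∑ t ∈ Finset.range L, g (t : ZMod L) = ∑ t : ZMod L, g t := by
  refine Finset.sum_bij' (fun (t : ℕ) _ => (t : ZMod L)) (fun (t : ZMod L) _ => t.val) ?_ ?_ ?_ ?_ ?_
  · simp
  · intro a _; simpa using ZMod.val_lt a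
  · intro a ha
    exact ZMod.val_cast_of_lt (by simpa using ha)
  · intro a _; simp
  · simp

lemma sum_range_two_mul (n : ℕ) (g : ℕ → ℕ) :
    ∑ k ∈ Finset.range (2 * n), g k = ∑ t ∈ Finset.range n, (g (2 * t) + g (2 * t + 1)) := by
  induction n with
  | zero => simp
  | succ n ih => rw [show 2 * (n + 1) = 2 * n + 1 + 1 by ring, Finset.sum_range_succ,
      Finset.sum_range_succ, ih, Finset.sum_range_succ]; ring

/-- local edge energies -/
noncomputable def hh {L q : ℕ} (σ : Conf L q) (p r : ZMod L × ZMod L) : ℕ :=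
  if σ (p, false) ≠ σ (r, true) then 1 else 0

lemma chg_sum {L q : ℕ} (σ : Conf L q) (d : Fin 3) (ℓ : ZMod L) :
    chg (2 * L) (sq σ d ℓ) = ∑ t ∈ Finset.range L,
      ((if sq σ d ℓ (2 * t) ≠ sq σ d ℓ (2 * t + 1) then 1 else 0) +
       (if sq σ d ℓ (2 * t + 1) ≠ sq σ d ℓ (2 * t + 1 + 1) then 1 else 0)) := by
  unfold chg
  rw [Nat.count_eq_card_filter_range, Finset.card_filter, sum_range_two_mul]

lemma cyc_even (L : ℕ) (d : Fin 3) (ℓ : ZMod L) (t : ℕ) : cyc L d ℓ (2 * t) =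
    if d = 0 then (((t : ZMod L), ℓ), false) else if d = 1 then ((ℓ, (t : ZMod L)), false)
    else (((t : ZMod L), ℓ - t), false) := by
  unfold cyc
  rw [show 2 * t / 2 = t by omega, show 2 * t % 2 = 0 by omega]
  simp

lemma cyc_odd (L : ℕ) (d : Fin 3) (ℓ : ZMod L) (t : ℕ) : cyc L d ℓ (2 * t + 1) =
    if d = 0 then (((t : ZMod L), ℓ), true) else if d = 1 then ((ℓ, (t : ZMod L)), true)
    else (((t : ZMod L), ℓ - 1 - t), true) := by
  unfold cyc
  rw [show (2 * t + 1) / 2 = t by omega, show (2 * t + 1) % 2 = 1 by omega]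
  simp

lemma chg0 {L q : ℕ} [NeZero L] (σ : Conf L q) (ℓ : ZMod L) : chg (2 * L) (sq σ 0 ℓ) =
    ∑ t : ZMod L, (hh σ (t, ℓ) (t, ℓ) + hh σ (t + 1, ℓ) (t, ℓ)) := by
  rw [chg_sum, ← sum_range_zmod]
  refine Finset.sum_congr rfl fun t _ => ?_
  rw [show 2 * t + 1 + 1 = 2 * (t + 1) by ring]
  simp only [sq, cyc_even, cyc_odd, hh, if_true, Nat.cast_add, Nat.cast_one]
  congr 1
  simp only [ne_comm]

lemma chg1 {L q : ℕ} [NeZero L] (σ : Conf L q) (ℓ : ZMod L) : chg (2 * L) (sq σ 1 ℓ) =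
    ∑ t : ZMod L, (hh σ (ℓ, t) (ℓ, t) + hh σ (ℓ, t + 1) (ℓ, t)) := by
  rw [chg_sum, ← sum_range_zmod]
  refine Finset.sum_congr rfl fun t _ => ?_
  rw [show 2 * t + 1 + 1 = 2 * (t + 1) by ring]
  simp only [sq, cyc_even, cyc_odd, hh, if_true, Nat.cast_add, Nat.cast_one,
    show (1 : Fin 3) ≠ 0 by decide, if_false]
  congr 1
  simp only [ne_comm]

lemma chg2 {L q : ℕ} [NeZero L] (σ : Conf L q) (ℓ : ZMod L) : chg (2 * L) (sq σ 2 ℓ) =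
    ∑ t : ZMod L, (hh σ (t, ℓ - t) (t, ℓ - t - 1) + hh σ (t + 1, ℓ - t - 1) (t, ℓ - t - 1)) := by
  rw [chg_sum, ← sum_range_zmod]
  refine Finset.sum_congr rfl fun t _ => ?_
  rw [show 2 * t + 1 + 1 = 2 * (t + 1) by ring]
  simp only [sq, cyc_even, cyc_odd, hh, Nat.cast_add, Nat.cast_one,
    show (2 : Fin 3) ≠ 0 by decide, show (2 : Fin 3) ≠ 1 by decide, if_false]
  rw [show ℓ - 1 - (t : ZMod L) = ℓ - t - 1 by ring, show ℓ - ((t : ZMod L) + 1) = ℓ - t - 1 by ring]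
  congr 1
  simp only [ne_comm]

lemma ham_sum {L q : ℕ} [NeZero L] (hL : 2 ≤ L) (σ : Conf L q) : Ham L q σ =
    ∑ x : ZMod L, ∑ y : ZMod L,
      (hh σ (x, y) (x, y) + hh σ (x, y) (x - 1, y) + hh σ (x, y) (x, y - 1)) := by
  have : Fact (1 < L) := ⟨by omega⟩
  unfold Ham
  rw [Nat.card_eq_fintype_card, Fintype.card_subtype, Finset.card_filter,
    Fintype.sum_prod_type, Fintype.sum_prod_type, Fintype.sum_prod_type]
  refine Finset.sum_congr rfl fun x _ => Finset.sum_congr rfl fun y _ => ?_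
  rw [Fintype.sum_bool]
  simp only [Bool.true_eq_false, false_and, if_false, Finset.sum_const_zero, zero_add, true_and]
  rw [Fintype.sum_prod_type]
  simp only [Fintype.sum_bool]
  have key : ∀ r : ZMod L × ZMod L,
      ((if hexAdj ((x, y), false) (r, true) ∧ σ ((x, y), false) ≠ σ (r, true) then 1 else 0) +
      (if hexAdj ((x, y), false) (r, false) ∧ σ ((x, y), false) ≠ σ (r, false) then 1 else 0) : ℕ) =
      (if r = (x, y) then hh σ (x, y) r else 0) + (if r = (x - 1, y) then hh σ (x, y) r else 0) +
      (if r = (x, y - 1) then hh σ (x, y) r else 0) := by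
    intro r
    have e1 : (x, y) ≠ (x - 1, y) := by simp [Prod.ext_iff, eq_sub_iff_add_eq]
    have e2 : (x, y) ≠ (x, y - 1) := by simp [Prod.ext_iff, eq_sub_iff_add_eq]
    have e3 : (x - 1, y) ≠ (x, y - 1) := by simp [Prod.ext_iff]
    by_cases r1 : r = (x, y)
    · subst r1; simp [hexAdj, hh, e1, e2]
    by_cases r2 : r = (x - 1, y)
    · subst r2; simp [hexAdj, hh, e1.symm, e3]
    by_cases r3 : r = (x, y - 1)
    · subst r3; simp [hexAdj, hh, e2.symm, e3.symm]
    simp [hexAdj, r1, r2, r3]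
  rw [Finset.sum_congr rfl fun r _ => key r]
  simp [Finset.sum_add_distrib]

lemma two_ham {L q : ℕ} [NeZero L] (hL : 2 ≤ L) (σ : Conf L q) :
    ∑ ℓ : ZMod L, chg (2 * L) (sq σ 0 ℓ) + ∑ ℓ : ZMod L, chg (2 * L) (sq σ 1 ℓ) +
      ∑ ℓ : ZMod L, chg (2 * L) (sq σ 2 ℓ) = 2 * Ham L q σ := by
  rw [ham_sum hL]
  simp only [chg0, chg1, chg2, Finset.sum_add_distrib]
  have a1 : ∑ ℓ : ZMod L, ∑ t : ZMod L, hh σ (t, ℓ) (t, ℓ) =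
      ∑ x : ZMod L, ∑ y : ZMod L, hh σ (x, y) (x, y) := Finset.sum_comm
  have a2 : ∑ ℓ : ZMod L, ∑ t : ZMod L, hh σ (t + 1, ℓ) (t, ℓ) =
      ∑ x : ZMod L, ∑ y : ZMod L, hh σ (x, y) (x - 1, y) := by
    rw [Finset.sum_comm, ← Equiv.sum_comp (Equiv.addRight (1 : ZMod L))
      (fun x => ∑ y : ZMod L, hh σ (x, y) (x - 1, y))]
    simp
  have a3 : ∑ ℓ : ZMod L, ∑ t : ZMod L, hh σ (ℓ, t + 1) (ℓ, t) =
      ∑ x : ZMod L, ∑ y : ZMod L, hh σ (x, y) (x, y - 1) := by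
    refine Finset.sum_congr rfl fun x _ => ?_
    rw [← Equiv.sum_comp (Equiv.addRight (1 : ZMod L)) (fun y => hh σ (x, y) (x, y - 1))]
    simp
  have a4 : ∑ ℓ : ZMod L, ∑ t : ZMod L, hh σ (t, ℓ - t) (t, ℓ - t - 1) =
      ∑ x : ZMod L, ∑ y : ZMod L, hh σ (x, y) (x, y - 1) := by
    rw [Finset.sum_comm]
    refine Finset.sum_congr rfl fun x _ => ?_
    rw [← Equiv.sum_comp (Equiv.subRight (x : ZMod L)) (fun y => hh σ (x, y) (x, y - 1))]
    simp
  have a5 : ∑ ℓ : ZMod L, ∑ t : ZMod L, hh σ (t + 1, ℓ - t - 1) (t, ℓ - t - 1) =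
      ∑ x : ZMod L, ∑ y : ZMod L, hh σ (x, y) (x - 1, y) := by
    rw [Finset.sum_comm, ← Equiv.sum_comp (Equiv.addRight (1 : ZMod L))
      (fun x => ∑ y : ZMod L, hh σ (x, y) (x - 1, y))]
    refine Finset.sum_congr rfl fun x _ => ?_
    simp only [Equiv.coe_addRight, add_sub_cancel_right]
    rw [← Equiv.sum_comp (Equiv.subRight (x + 1 : ZMod L)) (fun y => hh σ (x + 1, y) (x, y))]
    simp [sub_sub]
  rw [a1, a2, a3, a4, a5]
  ring

lemma mem_strip0 {L : ℕ} (y : ZMod L) (v : Site L) : v ∈ stripSet L 0 y ↔ v.1.2 = y := by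
  simp [stripSet]

lemma row_hit {L : ℕ} (d : Fin 3) (hd : d ≠ 0) (ℓ y : ZMod L) :
    ∃ v ∈ stripSet L d ℓ, v ∈ stripSet L 0 y := by
  by_cases h1 : d = 1
  · exact ⟨((ℓ, y), false), by simp [stripSet, h1], by simp [stripSet]⟩
  · exact ⟨((ℓ - y, y), false), by simp [stripSet, h1, hd], by simp [stripSet]⟩

lemma four_vert {L q : ℕ} [NeZero L] (σ : Conf L q) (a b : Fin q) (hab : a ≠ b) (z : ZMod L)
    (i m j : ℕ) (him : i ≤ m) (hmj : m ≤ j) (hj : j < L)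
    (hz : IsBridgeWith L q σ 0 z b) (hi : IsBridgeWith L q σ 0 (z + i) a)
    (hjj : IsBridgeWith L q σ 0 (z + j) a) (v : Site L) (hv : v ∈ stripSet L 0 (z + m))
    (hva : σ v ≠ a) : ∃ ℓ, 4 ≤ chg (2 * L) (sq σ 1 ℓ) := by
  obtain ⟨⟨x, y⟩, p⟩ := v
  simp only [mem_strip0] at hv
  subst hv
  have hzv : ((z.val : ℕ) : ZMod L) = z := ZMod.natCast_zmod_val z
  have f0 : sq σ 1 x (2 * z.val) = b := by
    apply hz; rw [mem_strip0, cyc_even]; simp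
  have fi : sq σ 1 x (2 * (z.val + i)) = a := by
    apply hi; rw [mem_strip0, cyc_even]; simp
  have fj : sq σ 1 x (2 * (z.val + j)) = a := by
    apply hjj; rw [mem_strip0, cyc_even]; simp
  have hmjlt : m < j := by
    rcases hmj.lt_or_eq with h | h
    · exact h
    · subst h; exact absurd (hjj _ (by simp [mem_strip0])) hva
  obtain ⟨k, hk1, hk2, hk3⟩ : ∃ k, 2 * (z.val + m) ≤ k ∧ k ≤ 2 * (z.val + m) + 1 ∧
      cyc L 1 x k = ((x, z + m), p) := by
    cases p
    · exact ⟨2 * (z.val + m), by omega, by omega, by rw [cyc_even]; simp⟩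
    · exact ⟨2 * (z.val + m) + 1, by omega, by omega, by rw [cyc_odd]; simp⟩
  have fk : sq σ 1 x k ≠ a := by unfold sq; rwa [hk3]
  refine ⟨x, four_le_chg _ _ (sq_periodic σ 1 x) (2 * z.val) (2 * (z.val + i)) k
    (2 * (z.val + j)) (by omega) (by omega) (by omega) (by omega) ?_ ?_ ?_ ?_⟩
  · rw [f0, fi]; exact hab.symm
  · rw [fi]; exact fk.symm
  · rw [fj]; exact fk
  · rw [f0, fj]; exact hab

lemma four_diag {L q : ℕ} [NeZero L] (σ : Conf L q) (a b : Fin q) (hab : a ≠ b) (z : ZMod L)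
    (i m j : ℕ) (him : i ≤ m) (hmj : m ≤ j) (hj : j < L)
    (hz : IsBridgeWith L q σ 0 z b) (hi : IsBridgeWith L q σ 0 (z + i) a)
    (hjj : IsBridgeWith L q σ 0 (z + j) a) (v : Site L) (hv : v ∈ stripSet L 0 (z + m))
    (hva : σ v ≠ a) : ∃ ℓ, 4 ≤ chg (2 * L) (sq σ 2 ℓ) := by
  obtain ⟨⟨x, y⟩, p⟩ := v
  simp only [mem_strip0] at hv
  subst hv
  have hmjlt : m < j := by
    rcases hmj.lt_or_eq with h | h
    · exact h
    · subst h; exact absurd (hjj _ (by simp [mem_strip0])) hva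
  obtain ⟨ℓ, hℓ⟩ : ∃ ℓ : ZMod L, ((x, z + m), p) ∈ stripSet L 2 ℓ := by
    cases p
    · exact ⟨x + (z + m), by simp [stripSet]⟩
    · exact ⟨x + (z + m) + 1, by simp [stripSet]⟩
  simp only [stripSet, show (2 : Fin 3) ≠ 0 by decide, show (2 : Fin 3) ≠ 1 by decide,
    if_false, Set.mem_ofPred_eq] at hℓ
  obtain ⟨T, hT⟩ : ∃ T : ℕ, T = (ℓ - z).val := ⟨_, rfl⟩
  have hTv : ((T : ℕ) : ZMod L) = ℓ - z := by rw [hT]; exact ZMod.natCast_zmod_val _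
  have cst : ∀ n ≤ L, ((T + (L - n) : ℕ) : ZMod L) = ℓ - z - n := by
    intro n hn
    rw [Nat.cast_add, Nat.cast_sub hn, ZMod.natCast_self, hTv]; ring
  have f0 : sq σ 2 ℓ (2 * T) = b := by
    apply hz; rw [mem_strip0, cyc_even]; simp [hTv]
  have fi : sq σ 2 ℓ (2 * (T + (L - i))) = a := by
    apply hi; rw [mem_strip0, cyc_even, cst i (by omega)]; simp; ring
  have fj : sq σ 2 ℓ (2 * (T + (L - j))) = a := by
    apply hjj; rw [mem_strip0, cyc_even, cst j (by omega)]; simp; ring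
  obtain ⟨k, hk1, hk2, hk3⟩ : ∃ k, k ≤ 2 * (T + (L - m)) ∧ 2 * (T + (L - m)) ≤ k + 1 ∧
      cyc L 2 ℓ k = ((x, z + m), p) := by
    cases p
    · refine ⟨2 * (T + (L - m)), by omega, by omega, ?_⟩
      rw [cyc_even, cst m (by omega)]
      simp at hℓ
      simp [← hℓ]
      constructor <;> ring
    · refine ⟨2 * (T + (L - (m + 1))) + 1, by omega, by omega, ?_⟩
      rw [cyc_odd, cst (m + 1) (by omega)]
      simp [eq_sub_iff_add_eq] at hℓ
      simp [← hℓ]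
      constructor <;> ring
  have fk : sq σ 2 ℓ k ≠ a := by unfold sq; rwa [hk3]
  refine ⟨ℓ, four_le_chg _ _ (sq_periodic σ 2 ℓ) (2 * T) (2 * (T + (L - j))) k
    (2 * (T + (L - i))) (by omega) (by omega) (by omega) (by omega) ?_ ?_ ?_ ?_⟩
  · rw [f0, fj]; exact hab.symm
  · rw [fj]; exact fk.symm
  · rw [fi]; exact fk
  · rw [f0, fi]; exact hab

lemma sum_ge_two {L : ℕ} [NeZero L] (g : ZMod L → ℕ) (hg : ∀ ℓ, 2 ≤ g ℓ) (ℓ : ZMod L) :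
    2 * L + g ℓ ≤ ∑ x, g x + 2 := by
  have h1 : g ℓ + (Finset.univ.erase ℓ).sum g = Finset.univ.sum g :=
    Finset.add_sum_erase Finset.univ g (Finset.mem_univ ℓ)
  have h2 := Finset.card_nsmul_le_sum (Finset.univ.erase ℓ) g 2 (fun x _ => hg x)
  rw [Finset.card_erase_of_mem (Finset.mem_univ ℓ), Finset.card_univ, ZMod.card] at h2
  have := NeZero.pos L
  simp only [smul_eq_mul] at h2
  change 2 * L + g ℓ ≤ Finset.univ.sum g + 2
  omega

/-- the horizontal strips contribute at least `2 (L - k)` -/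
lemma sum_row {L q : ℕ} [NeZero L] (σ : Conf L q) :
    2 * L ≤ ∑ x : ZMod L, chg (2 * L) (sq σ 0 x) +
      2 * Nat.card {ℓ : ZMod L // IsBridge L q σ 0 ℓ} := by
  rw [Nat.card_eq_fintype_card, Fintype.card_subtype, Finset.card_filter, Finset.mul_sum,
    ← Finset.sum_add_distrib]
  have h := Finset.card_nsmul_le_sum (Finset.univ : Finset (ZMod L))
    (fun x => chg (2 * L) (sq σ 0 x) + 2 * (if IsBridge L q σ 0 x then 1 else 0)) 2 (by
      intro x _
      by_cases hb : IsBridge L q σ 0 x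
      · simp [hb]
      · simpa [hb] using two_le_of_not_bridge σ 0 x hb)
  rw [Finset.card_univ, ZMod.card] at h
  simp only [smul_eq_mul] at h
  omega

lemma sum_row_at {L q : ℕ} [NeZero L] (σ : Conf L q) (ℓ : ZMod L) (hℓ : ¬ IsBridge L q σ 0 ℓ) :
    2 * L + chg (2 * L) (sq σ 0 ℓ) ≤ ∑ x : ZMod L, chg (2 * L) (sq σ 0 x) +
      2 * Nat.card {ℓ : ZMod L // IsBridge L q σ 0 ℓ} + 2 := by
  rw [Nat.card_eq_fintype_card, Fintype.card_subtype, Finset.card_filter, Finset.mul_sum,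
    ← Finset.sum_add_distrib]
  have h := sum_ge_two
    (fun x => chg (2 * L) (sq σ 0 x) + 2 * (if IsBridge L q σ 0 x then 1 else 0)) (by
      intro x
      by_cases hb : IsBridge L q σ 0 x
      · simp [hb]
      · simpa [hb] using two_le_of_not_bridge σ 0 x hb) ℓ
  simpa [hℓ] using h

lemma circConn_of {L q : ℕ} [NeZero L] (σ : Conf L q) (a b : Fin q) (hab : a ≠ b)
    (hsmall : (∃ ℓ, 4 ≤ chg (2 * L) (sq σ 1 ℓ)) → (∃ ℓ, 4 ≤ chg (2 * L) (sq σ 2 ℓ)) → False)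
    (hb : {ℓ : ZMod L | IsBridgeWith L q σ 0 ℓ b}.Nonempty) :
    CircConn L {ℓ : ZMod L | IsBridgeWith L q σ 0 ℓ a} := by
  obtain ⟨z, hz⟩ := hb
  have claim : ∀ i m j : ℕ, i ≤ m → m ≤ j → j < L → IsBridgeWith L q σ 0 (z + i) a →
      IsBridgeWith L q σ 0 (z + j) a → IsBridgeWith L q σ 0 (z + m) a := by
    intro i m j h1 h2 h3 h4 h5 v hv
    by_contra hne
    exact hsmall (four_vert σ a b hab z i m j h1 h2 h3 hz h4 h5 v hv hne)
      (four_diag σ a b hab z i m j h1 h2 h3 hz h4 h5 v hv hne)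
  intro x hx y hy
  obtain ⟨i, hi, rfl⟩ : ∃ i < L, x = z + (i : ℕ) :=
    ⟨(x - z).val, ZMod.val_lt _, by rw [ZMod.natCast_zmod_val]; ring⟩
  obtain ⟨j, hj, rfl⟩ : ∃ j < L, y = z + (j : ℕ) :=
    ⟨(y - z).val, ZMod.val_lt _, by rw [ZMod.natCast_zmod_val]; ring⟩
  rcases le_total i j with hij | hij
  · refine ⟨j - i, fun n => z + ((i + n : ℕ) : ZMod L), by simp, ?_, ?_, ?_⟩
    · simp only []; rw [Nat.add_sub_cancel' hij]
    · intro n hn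
      exact claim i (i + n) j (by omega) (by omega) hj hx hy
    · intro n _
      left; push_cast; ring
  · refine ⟨i - j, fun n => z + ((i - n : ℕ) : ZMod L), by simp, ?_, ?_, ?_⟩
    · simp only []; rw [Nat.sub_sub_self hij]
    · intro n hn
      exact claim j (i - n) i (by omega) (by omega) hi hy hx
    · intro n hn
      right
      have : i - n = (i - (n + 1)) + 1 := by omega
      simp only []
      rw [this]; push_cast; ring

/-- Lemma 6.6 (hexagonal lattice): suppose a cross-free `σ` has `H(σ) ≤ 2L+2`, exactly
`k ∈ {L-2, L-1}` horizontal bridges, and at least one vertical or diagonal semibridge.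
Then (1) there are spins `a ≠ b` such that every horizontal bridge is an `a`- or
`b`-bridge; (2) if `P_a` and `P_b` are both nonempty then they are connected subsets of
`𝕋_L`, and (a) if `k = L-2` then all non-bridge strips are `{a,b}`-semibridges and
`H(σ) = 2L+2`; (b) if `k = L-1` and `H(σ) ≤ 2L+1` then all non-bridge strips are
`{a,b}`-semibridges. -/
theorem crosschar (L q : ℕ) (hL : 8 ≤ L) (hq : 2 ≤ q) (σ : Conf L q)
    (hcf : CrossFree L q σ) (hH : Ham L q σ ≤ 2 * L + 2) (k : ℕ)
    (hk : k = L - 2 ∨ k = L - 1)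
    (hcount : Nat.card {ℓ : ZMod L // IsBridge L q σ 0 ℓ} = k)
    (hsemi : ∃ (d : Fin 3) (ℓ : ZMod L), d ≠ 0 ∧ IsSemibridge L q σ d ℓ) :
    ∃ a b : Fin q, a ≠ b ∧
      (∀ ℓ : ZMod L, IsBridge L q σ 0 ℓ →
        IsBridgeWith L q σ 0 ℓ a ∨ IsBridgeWith L q σ 0 ℓ b) ∧
      ({ℓ : ZMod L | IsBridgeWith L q σ 0 ℓ a}.Nonempty →
        {ℓ : ZMod L | IsBridgeWith L q σ 0 ℓ b}.Nonempty →
        CircConn L {ℓ : ZMod L | IsBridgeWith L q σ 0 ℓ a} ∧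
        CircConn L {ℓ : ZMod L | IsBridgeWith L q σ 0 ℓ b} ∧
        (k = L - 2 →
          (∀ (d : Fin 3) (ℓ : ZMod L), ¬ IsBridge L q σ d ℓ →
            IsSemibridgePair L q σ d ℓ a b) ∧ Ham L q σ = 2 * L + 2) ∧
        (k = L - 1 → Ham L q σ ≤ 2 * L + 1 →
          ∀ (d : Fin 3) (ℓ : ZMod L), ¬ IsBridge L q σ d ℓ →
            IsSemibridgePair L q σ d ℓ a b)) := by
  have : NeZero L := ⟨by omega⟩
  obtain ⟨d0, ℓ0, hd0, a, b, hsb⟩ := hsemi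
  have hab := hsb.1
  refine ⟨a, b, hab, ?_, ?_⟩
  · rintro ℓ ⟨c, hc⟩
    obtain ⟨v, hv1, hv2⟩ := row_hit d0 hd0 ℓ0 ℓ
    have hvc := hc v hv2
    rcases hsb.2.1 v hv1 with h | h
    · left; rw [← h, hvc]; exact hc
    · right; rw [← h, hvc]; exact hc
  intro hA hB
  obtain ⟨ya, hya⟩ := id hA
  obtain ⟨yb, hyb⟩ := id hB
  have hitA : ∀ d : Fin 3, d ≠ 0 → ∀ ℓ : ZMod L, ∃ v ∈ stripSet L d ℓ, σ v = a := by
    intro d hd ℓ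
    obtain ⟨v, h1, h2⟩ := row_hit d hd ℓ ya
    exact ⟨v, h1, hya v h2⟩
  have hitB : ∀ d : Fin 3, d ≠ 0 → ∀ ℓ : ZMod L, ∃ v ∈ stripSet L d ℓ, σ v = b := by
    intro d hd ℓ
    obtain ⟨v, h1, h2⟩ := row_hit d hd ℓ yb
    exact ⟨v, h1, hyb v h2⟩
  have hge : ∀ d : Fin 3, d ≠ 0 → ∀ ℓ : ZMod L, 2 ≤ chg (2 * L) (sq σ d ℓ) := by
    intro d hd ℓ
    obtain ⟨v, hv, hva⟩ := hitA d hd ℓ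
    obtain ⟨w, hw, hwb⟩ := hitB d hd ℓ
    exact two_le_of_ne σ d ℓ v w hv hw (by rw [hva, hwb]; exact hab)
  have g1 := sum_ge_two _ (hge 1 (by decide))
  have g2 := sum_ge_two _ (hge 2 (by decide))
  have hbase1 : 2 * L ≤ ∑ x : ZMod L, chg (2 * L) (sq σ 1 x) := by
    have := g1 0; have := hge 1 (by decide) 0; omega
  have hbase2 : 2 * L ≤ ∑ x : ZMod L, chg (2 * L) (sq σ 2 x) := by
    have := g2 0; have := hge 2 (by decide) 0; omega
  have hrow := sum_row σ
  have htot := two_ham (by omega) σ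
  rw [hcount] at hrow
  have hsmall : (∃ ℓ, 4 ≤ chg (2 * L) (sq σ 1 ℓ)) → (∃ ℓ, 4 ≤ chg (2 * L) (sq σ 2 ℓ)) →
      False := by
    rintro ⟨ℓ, h1⟩ ⟨ℓ2, h2⟩
    have := g1 ℓ
    have := g2 ℓ2
    omega
  -- tight case: all non-bridge strips are semibridges
  have tight : 2 * Ham L q σ ≤ 4 * L + 2 * (L - k) → ∀ (d : Fin 3) (ℓ : ZMod L),
      ¬ IsBridge L q σ d ℓ → IsSemibridgePair L q σ d ℓ a b := by
    intro ht
    have hne : ∀ d : Fin 3, d ≠ 0 → ∀ ℓ : ZMod L, IsSemibridgePair L q σ d ℓ a b := by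
      intro d hd ℓ
      obtain ⟨v, hv, hva⟩ := hitA d hd ℓ
      obtain ⟨w, hw, hwb⟩ := hitB d hd ℓ
      apply semibridge_of σ d ℓ a b hab v w hv hw hva hwb
      have hd12 : d = 1 ∨ d = 2 := by omega
      rcases hd12 with rfl | rfl
      · have := g1 ℓ; omega
      · have := g2 ℓ; omega
    intro d ℓ hnb
    by_cases hd : d = 0
    · subst hd
      have hval : ∀ v : Site L, σ v = a ∨ σ v = b := fun v =>
        (hne 1 (by decide) v.1.1).2.1 v (by simp [stripSet])
      have hr := sum_row_at σ ℓ hnb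
      rw [hcount] at hr
      have hxa : ∃ v ∈ stripSet L 0 ℓ, σ v = a := by
        by_contra! hc
        exact hnb ⟨b, fun v hv => (hval v).resolve_left (hc v hv)⟩
      have hxb : ∃ v ∈ stripSet L 0 ℓ, σ v = b := by
        by_contra! hc
        exact hnb ⟨a, fun v hv => (hval v).resolve_right (hc v hv)⟩
      obtain ⟨v, hv, hva⟩ := hxa
      obtain ⟨w, hw, hwb⟩ := hxb
      exact semibridge_of σ 0 ℓ a b hab v w hv hw hva hwb (by omega)
    · exact hne d hd ℓ
  refine ⟨circConn_of σ a b hab hsmall hB, circConn_of σ b a hab.symm hsmall hA, ?_, ?_⟩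
  · intro hk2
    exact ⟨tight (by omega), by omega⟩
  · intro hk1 hH1
    exact tight (by omega)

end IsingHex
end
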